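/- arXiv:0909.3802 — 2 statements merged into one kernel-verified Lean document; each statement's English description precedes it below -/
import Mathlib

section
/- Let s ≥ 2 and m_1 ≥ m_2 ≥ … ≥ m_s ≥ 0 be integers with m_1 + m_2 < n. Then there exist subspaces W_1, …, W_s of ℂ^{n+1} with dim W_i = m_i + 1 and W_i ∩ W_j = {0} for i ≠ j such that dim Q(W_1,…,W_s) = max{ C(n+2,2) − Σ_{i=1}^s C(m_i+2,2), 0 }; that is, for a generic configuration of linear spaces Λ of weight vector (m_1,…,m_s) in P^n with pairwise disjoint components, dim (I_Λ)_2 = max{ C(n+2,2) − Σ_{i=1}^s C(m_i+2,2), 0 }. -/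
/-- The vector space `Q(W_1, …, W_s)` of quadratic forms on `ℂ^{n+1}` vanishing identically
on each of the subspaces `W 1, …, W s`. -/
def quadVanishing (n s : ℕ) (W : ℕ → Submodule ℂ (Fin (n + 1) → ℂ)) :
    Submodule ℂ (QuadraticForm ℂ (Fin (n + 1) → ℂ)) where
  carrier := {q | ∀ i ∈ Finset.Icc 1 s, ∀ v ∈ W i, q v = 0}
  add_mem' := by
    intro a b ha hb i hi v hv
    simp [ha i hi v hv, hb i hi v hv]
  zero_mem' := by intro i hi v hv; simp
  smul_mem' := by
    intro c a ha i hi v hv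
    simp [ha i hi v hv]


/-- Symmetric bilinear forms. -/
def SymB (V : Type*) [AddCommGroup V] [Module ℂ V] : Submodule ℂ (V →ₗ[ℂ] V →ₗ[ℂ] ℂ) where
  carrier := {E | ∀ a b, E a b = E b a}
  add_mem' := by
    intro E F hE hF a b
    simp [hE a b, hF a b]
  zero_mem' := by intro a b; simp
  smul_mem' := by
    intro c E hE a b
    simp [hE a b]

noncomputable instance instSymBGroup (V : Type*) [AddCommGroup V] [Module ℂ V] :
    AddCommGroup (SymB V) := Submodule.addCommGroup _

noncomputable instance instSymBModule (V : Type*) [AddCommGroup V] [Module ℂ V] :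
    Module ℂ (SymB V) := Submodule.module _

noncomputable instance instSymBFin (V : Type*) [AddCommGroup V] [Module ℂ V]
    [FiniteDimensional ℂ V] : FiniteDimensional ℂ (SymB V) :=
  FiniteDimensional.finiteDimensional_submodule (SymB V)

theorem finrank_SymB (V : Type*) [AddCommGroup V] [Module ℂ V] [FiniteDimensional ℂ V] :
    Module.finrank ℂ (SymB V) = (Module.finrank ℂ V + 1).choose 2 := by
  classical
  let b := Module.finBasis ℂ V
  let Φ : SymB V →ₗ[ℂ] (Sym2 (Fin (Module.finrank ℂ V)) → ℂ) :=
    { toFun := fun E => Sym2.lift ⟨fun i j => E.1 (b i) (b j), fun i j => E.2 _ _⟩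
      map_add' := by
        intro E F
        ext z
        induction z with
        | _ i j => simp
      map_smul' := by
        intro c E
        ext z
        induction z with
        | _ i j => simp }
  have hΦ : ∀ (E : SymB V) i j, Φ E s(i, j) = E.1 (b i) (b j) := fun E i j => rfl
  have hinj : Function.Injective Φ := by
    intro E F h
    apply Subtype.ext
    refine b.ext fun i => b.ext fun j => ?_
    rw [← hΦ, ← hΦ, h]
  have hsurj : Function.Surjective Φ := by
    intro f
    let E := Matrix.toLinearMap₂ b b (Matrix.of fun i j => f s(i, j))
    have hE : ∀ i j, E (b i) (b j) = f s(i, j) := by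
      intro i j
      simp [E, Finsupp.single_apply]
    have hs : E = E.flip := by
      refine b.ext fun i => b.ext fun j => ?_
      rw [LinearMap.flip_apply, hE, hE, Sym2.eq_swap]
    refine ⟨⟨E, fun x y => ?_⟩, ?_⟩
    · conv_lhs => rw [hs]
      rfl
    · ext z
      induction z with
      | _ i j => rw [hΦ, hE]
  rw [(LinearEquiv.ofBijective Φ ⟨hinj, hsurj⟩).finrank_eq, Module.finrank_fintype_fun_eq_card,
    Sym2.card, Fintype.card_fin]

theorem finrank_le_of_ker_le {E H G : Type*} [AddCommGroup E] [Module ℂ E] [AddCommGroup H]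
    [Module ℂ H] [FiniteDimensional ℂ H]
    [AddCommGroup G] [Module ℂ G] (f : E →ₗ[ℂ] H) (g : E →ₗ[ℂ] G)
    (hg : Function.Surjective g) (hk : LinearMap.ker f ≤ LinearMap.ker g) :
    Module.finrank ℂ G ≤ Module.finrank ℂ H := by
  obtain ⟨s, hs⟩ := g.exists_rightInverse_of_surjective (LinearMap.range_eq_top.2 hg)
  apply LinearMap.finrank_le_finrank_of_injective (f := f ∘ₗ s)
  rw [← LinearMap.ker_eq_bot, LinearMap.ker_eq_bot']
  intro x hx
  have : s x ∈ LinearMap.ker g := hk (by simpa using hx)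
  have h2 : g (s x) = x := by
    rw [← LinearMap.comp_apply, hs]; rfl
  rw [← h2]
  exact this

theorem finrank_lt_of_ker_le {E H G : Type*} [AddCommGroup E] [Module ℂ E] [AddCommGroup H]
    [Module ℂ H] [FiniteDimensional ℂ H]
    [AddCommGroup G] [Module ℂ G] (f : E →ₗ[ℂ] H) (g : E →ₗ[ℂ] G)
    (hg : Function.Surjective g) (b0 : H) (hb0 : b0 ≠ 0)
    (hk : ∀ (x : E) (c : ℂ), c • b0 = f x → g x = 0) :
    Module.finrank ℂ G + 1 ≤ Module.finrank ℂ H := by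
  have hq := Submodule.finrank_quotient_add_finrank (Submodule.span ℂ {b0})
  rw [finrank_span_singleton hb0] at hq
  rw [← hq]
  refine Nat.add_le_add_right
    (finrank_le_of_ker_le ((Submodule.span ℂ {b0}).mkQ ∘ₗ f) g hg ?_) 1
  intro x hx
  have h5 : f x ∈ Submodule.span ℂ {b0} := by simpa using hx
  obtain ⟨c, hc⟩ := Submodule.mem_span_singleton.1 h5
  exact hk x c hc

theorem flip_surj {V C : Type*} [AddCommGroup V] [Module ℂ V] [FiniteDimensional ℂ V]
    [AddCommGroup C] [Module ℂ C] [FiniteDimensional ℂ C]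
    (β : C →ₗ[ℂ] V →ₗ[ℂ] ℂ) (hβ : Function.Injective β) : Function.Surjective β.flip := by
  intro φ
  obtain ⟨ψ, hψ⟩ := LinearMap.dualMap_surjective_of_injective hβ φ
  obtain ⟨v, rfl⟩ := (Module.evalEquiv ℂ V).surjective ψ
  refine ⟨v, ?_⟩
  rw [← hψ]
  ext c
  simp

section core
variable {V : Type} [AddCommGroup V] [Module ℂ V] [FiniteDimensional ℂ V]
  {ι : Type} [Fintype ι] (L : ι → Type) [∀ i, AddCommGroup (L i)] [∀ i, Module ℂ (L i)]
  [∀ i, FiniteDimensional ℂ (L i)]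

/-- the local surjectivity -/
theorem local_surj {L : Type} [AddCommGroup L] [Module ℂ L] [FiniteDimensional ℂ L]
    (B : V →ₗ[ℂ] V →ₗ[ℂ] ℂ) (hB : ∀ a b, B a b = B b a)
    (X : L →ₗ[ℂ] V) (C : Submodule ℂ L) (hC : IsCompl (LinearMap.ker (B ∘ₗ X)) C)
    (S : Submodule ℂ V)
    (t : LinearMap.ker (B ∘ₗ X) →ₗ[ℂ] V ⧸ S) (E : SymB C) :
    ∃ M : L →ₗ[ℂ] V, (∀ a : LinearMap.ker (B ∘ₗ X), S.mkQ (M a) = t a) ∧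
      ∀ a b : C, B (M a) (X b) + B (X a) (M b) = E.1 a b := by
  obtain ⟨φ, hφ⟩ := Module.projective_lifting_property S.mkQ t S.mkQ_surjective
  let β : C →ₗ[ℂ] V →ₗ[ℂ] ℂ := B ∘ₗ X ∘ₗ C.subtype
  have hβ : Function.Injective β := by
    rw [← LinearMap.ker_eq_bot, LinearMap.ker_eq_bot']
    intro c hc
    have h1 : (c : L) ∈ LinearMap.ker (B ∘ₗ X) := by
      simpa [β] using hc
    have := Submodule.disjoint_def.1 hC.disjoint c h1 c.2
    exact Subtype.ext this
  obtain ⟨s, hs⟩ := β.flip.exists_rightInverse_of_surjective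
    (LinearMap.range_eq_top.2 (flip_surj β hβ))
  let ψ : C →ₗ[ℂ] V := s ∘ₗ ((2 : ℂ)⁻¹ • E.1)
  have hψ : ∀ a b : C, B (X b) (ψ a) = 2⁻¹ * E.1 a b := by
    intro a b
    have := LinearMap.congr_fun (LinearMap.congr_fun hs ((2 : ℂ)⁻¹ • E.1 a)) b
    simpa [ψ, β] using this
  refine ⟨LinearMap.ofIsCompl hC φ ψ, ?_, ?_⟩
  · intro a
    rw [LinearMap.ofIsCompl_apply_left, ← hφ]; rfl
  · intro a b
    rw [LinearMap.ofIsCompl_apply_right, LinearMap.ofIsCompl_apply_right, hB, hψ, hψ, E.2 b a]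
    ring

theorem exists_res (R U : Submodule ℂ V) (hU : IsCompl R U) :
    ∃ (H : Type) (_ : AddCommGroup H) (_ : Module ℂ H) (_ : FiniteDimensional ℂ H)
      (res : SymB V →ₗ[ℂ] H),
      Module.finrank ℂ H =
        Module.finrank ℂ U * Module.finrank ℂ R + (Module.finrank ℂ U + 1).choose 2 ∧
      ∀ E : SymB V, (∀ x ∈ R, ∀ y ∈ R, E.1 x y = 0) → res E = 0 → E = 0 := by
  classical
  let res : SymB V →ₗ[ℂ] (U →ₗ[ℂ] R →ₗ[ℂ] ℂ) × SymB U :=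
    { toFun := fun E => (E.1.domRestrict₁₂ U R, ⟨E.1.domRestrict₁₂ U U, fun a b => E.2 _ _⟩)
      map_add' := fun E F => rfl
      map_smul' := fun c E => rfl }
  have hres : ∀ E : SymB V, (∀ x ∈ R, ∀ y ∈ R, E.1 x y = 0) → res E = 0 → E = 0 := by
    intro E hE h
    have e1 : ∀ (u : U) (r : R), E.1 u r = 0 := fun u r =>
      LinearMap.congr_fun (LinearMap.congr_fun (congrArg Prod.fst h) u) r
    have e2 : ∀ (u : U) (r : U), E.1 u r = 0 := fun u r =>
      LinearMap.congr_fun (LinearMap.congr_fun (congrArg (fun z => (Prod.snd z).1) h) u) r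
    apply Subtype.ext
    ext x y
    obtain ⟨x1, hx1, x2, hx2, rfl⟩ := Submodule.mem_sup.1
      (show x ∈ R ⊔ U by rw [hU.sup_eq_top]; trivial)
    obtain ⟨y1, hy1, y2, hy2, rfl⟩ := Submodule.mem_sup.1
      (show y ∈ R ⊔ U by rw [hU.sup_eq_top]; trivial)
    have f1 := hE x1 hx1 y1 hy1
    have f2 := e1 ⟨x2, hx2⟩ ⟨y1, hy1⟩
    have f3 := e1 ⟨y2, hy2⟩ ⟨x1, hx1⟩
    have f4 := e2 ⟨x2, hx2⟩ ⟨y2, hy2⟩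
    have f5 := E.2 x1 y2
    simp only at f2 f3 f4
    simp [f1, f2, f4, f5, f3]
  have hH : Module.finrank ℂ ((U →ₗ[ℂ] R →ₗ[ℂ] ℂ) × SymB U) =
      Module.finrank ℂ U * Module.finrank ℂ R + (Module.finrank ℂ U + 1).choose 2 := by
    rw [Module.finrank_prod, finrank_SymB, Module.finrank_linearMap, Module.finrank_linearMap]
    simp
  exact ⟨_, inferInstance, inferInstance, inferInstance, res, hH, hres⟩

theorem core_ineq (B : V →ₗ[ℂ] V →ₗ[ℂ] ℂ) (hB : ∀ a b, B a b = B b a) (hB0 : B ≠ 0)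
    (X : ∀ i, L i →ₗ[ℂ] V) 
    (hiso : ∀ i a b, B (X i a) (X i b) = 0)
    (D : (∀ i, L i →ₗ[ℂ] V) →ₗ[ℂ] (V →ₗ[ℂ] V →ₗ[ℂ] ℂ))
    (hDs : ∀ M a b, D M a b = D M b a)
    (h2 : ∀ M i a b, B (M i a) (X i b) + D M (X i a) (X i b) + B (X i a) (M i b) = 0)
    (h3 : ∀ M x y, B x = 0 → B y = 0 → D M x y = 0)
    (h4 : ∀ M i a, B (X i a) = 0 → ∃ b, D M (X i a) + B (M i a) + B (X i b) = 0)
    (C : ∀ i, Submodule ℂ (L i)) (hC : ∀ i, IsCompl (LinearMap.ker (B ∘ₗ X i)) (C i))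
    (U : Submodule ℂ V) (hU : IsCompl (LinearMap.ker B) U) :
    ∑ i, (Module.finrank ℂ (LinearMap.ker (B ∘ₗ X i)) *
        Module.finrank ℂ (V ⧸ (LinearMap.range (X i) ⊔ LinearMap.ker B)) +
        (Module.finrank ℂ (C i) + 1).choose 2) + 1 ≤
      Module.finrank ℂ U * Module.finrank ℂ (LinearMap.ker B) + (Module.finrank ℂ U + 1).choose 2 := by
  classical
  let R := LinearMap.ker B
  -- the space H
  obtain ⟨H, _, _, _, res, hH, hres⟩ := exists_res (LinearMap.ker B) U hU
  let B' : SymB V := ⟨B, hB⟩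
  let b0 := res B'
  have hBR : ∀ x ∈ R, ∀ y ∈ R, B'.1 x y = 0 := by
    intro x hx y _
    have : B x = 0 := hx
    simp [B', this]
  have hb0 : b0 ≠ 0 := by
    intro h
    exact hB0 (congrArg Subtype.val (hres B' hBR h))
  let D' : (∀ i, L i →ₗ[ℂ] V) →ₗ[ℂ] SymB V := D.codRestrict (SymB V) hDs
  let S := fun i => LinearMap.range (X i) ⊔ LinearMap.ker B
  let g : (∀ i, L i →ₗ[ℂ] V) →ₗ[ℂ]
      (∀ i, (LinearMap.ker (B ∘ₗ X i) →ₗ[ℂ] V ⧸ S i) × SymB (C i)) :=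
    { toFun := fun M i => ((S i).mkQ ∘ₗ (M i).domRestrict _,
        ⟨(B.compl₁₂ (M i) (X i) + B.compl₁₂ (X i) (M i)).domRestrict₁₂ (C i) (C i), by
          intro a b
          simp only [LinearMap.domRestrict₁₂_apply, LinearMap.add_apply, LinearMap.compl₁₂_apply]
          rw [hB (M i a), hB (X i a), add_comm]⟩)
      map_add' := by
        intro M M'
        ext i
        · simp
        · rename_i a b
          change B ((M i + M' i) a) (X i b) + B (X i a) ((M i + M' i) b) =
            (B (M i a) (X i b) + B (X i a) (M i b)) + (B (M' i a) (X i b) + B (X i a) (M' i b))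
          simp only [LinearMap.add_apply, map_add]
          ring
      map_smul' := by
        intro c M
        ext i
        · simp
        · rename_i a b
          change B ((c • M i) a) (X i b) + B (X i a) ((c • M i) b) =
            c * (B (M i a) (X i b) + B (X i a) (M i b))
          simp only [LinearMap.smul_apply, map_smul, smul_eq_mul]
          ring }
  have hg : Function.Surjective g := by
    intro T
    choose M hM1 hM2 using fun i => local_surj B hB (X i) (C i) (hC i) (S i) (T i).1 (T i).2
    refine ⟨M, ?_⟩
    ext i a
    · exact hM1 i a
    · exact hM2 i _ _
  have hk : ∀ (M : ∀ i, L i →ₗ[ℂ] V) (c : ℂ), c • b0 = res (D' M) → g M = 0 := by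
    intro M c hc
    have h6 : D' M - c • B' = 0 := by
      apply hres
      · intro x hx y hy
        have e1 := hBR x hx y hy
        have e2 := h3 M x y hx hy
        have : (D' M).1 x y = 0 := e2
        simp [e1, this]
      · rw [map_sub, map_smul, ← hc, sub_self]
    have h7 : D M = c • B := congrArg Subtype.val (sub_eq_zero.1 h6)
    ext i a
    · change (S i).mkQ (M i a) = 0
      have ha : B (X i a) = 0 := a.2
      obtain ⟨b, hb⟩ := h4 M i a ha
      rw [h7] at hb
      have : B (M i a + X i b) = 0 := by
        simpa [ha] using hb
      rw [Submodule.mkQ_apply, Submodule.Quotient.mk_eq_zero]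
      have e : M i a = X i (-b) + (M i a + X i b) := by
        rw [map_neg]; abel
      rw [e]
      exact Submodule.add_mem_sup ⟨_, rfl⟩ this
    · rename_i b
      change B (M i a) (X i b) + B (X i a) (M i b) = 0
      have := h2 M i a b
      rw [h7] at this
      simpa [hiso] using this
  have key := finrank_lt_of_ker_le (res ∘ₗ D') g hg b0 hb0 hk
  have hG : Module.finrank ℂ (∀ i, (LinearMap.ker (B ∘ₗ X i) →ₗ[ℂ] V ⧸ S i) × SymB (C i)) =
      ∑ i, (Module.finrank ℂ (LinearMap.ker (B ∘ₗ X i)) * Module.finrank ℂ (V ⧸ S i) +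
        (Module.finrank ℂ (C i) + 1).choose 2) := by
    rw [Module.finrank_pi_fintype]
    apply Finset.sum_congr rfl
    intro i _
    rw [Module.finrank_prod, finrank_SymB, Module.finrank_linearMap]
  rw [hG, hH] at key
  exact key

end core

theorem three_aux (ρ x y z : ℤ) (hx : 1 ≤ x) (hy : 1 ≤ y) (hz : 1 ≤ z) (hxy : x + y ≤ ρ)
    (hxz : x + z ≤ ρ) (h1 : y ≤ x) (h2 : z ≤ x) :
    x * (x + 1) + y * (y + 1) + z * (z + 1) ≤ ρ * (ρ + 1) := by
  rcases le_total y z with h | h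
  · have : (x + z) * (x + z + 1) ≤ ρ * (ρ + 1) := by nlinarith
    nlinarith [mul_nonneg (sub_nonneg.2 h) (by linarith : (0:ℤ) ≤ y), mul_nonneg (sub_nonneg.2 h2) (by linarith : (0:ℤ) ≤ z), mul_nonneg (sub_nonneg.2 h) (by linarith : (0:ℤ) ≤ z)]
  · have : (x + y) * (x + y + 1) ≤ ρ * (ρ + 1) := by nlinarith
    nlinarith [mul_nonneg (sub_nonneg.2 h) (by linarith : (0:ℤ) ≤ y), mul_nonneg (sub_nonneg.2 h1) (by linarith : (0:ℤ) ≤ y), mul_nonneg (sub_nonneg.2 h) (by linarith : (0:ℤ) ≤ z)]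

theorem numeric_P {ι : Type*} [DecidableEq ι] (P : Finset ι) (ν ρ : ℤ) (σ g : ι → ℤ)
    (hν : 1 ≤ ν) (hρ : 0 ≤ ρ) (hσ : ∀ i ∈ P, 1 ≤ σ i) (hg0 : ∀ i ∈ P, 0 ≤ g i)
    (hg : ∀ i ∈ P, 2 * g i ≤ σ i) (hσρ : ∀ i ∈ P, σ i ≤ ρ)
    (hpair : ∀ i ∈ P, ∀ j ∈ P, i ≠ j → σ i + σ j ≤ ρ)
    (ha : ∑ i ∈ P, (4 * ν * σ i + 4 * (σ i * g i) + (ν - g i) * (ν - g i + 2)) + 8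
      ≤ 4 * (ν * (ν + 1) + 2 * ν * ρ)) :
    ∑ i ∈ P, σ i * (σ i + 1 - 2 * g i) ≤ ρ * (ρ + 1) := by
  by_cases hP : P.card ≤ 3
  · have h1 : ∑ i ∈ P, σ i * (σ i + 1 - 2 * g i) ≤ ∑ i ∈ P, σ i * (σ i + 1) := by
      apply Finset.sum_le_sum
      intro i hi
      nlinarith [hσ i hi, hg0 i hi]
    refine h1.trans ?_
    interval_cases hc : P.card
    · rw [Finset.card_eq_zero] at hc
      subst hc
      simp
      positivity
    · obtain ⟨x, rfl⟩ := Finset.card_eq_one.1 hc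
      have := hσρ x (by simp)
      have := hσ x (by simp)
      simp
      nlinarith
    · obtain ⟨x, y, hxy, rfl⟩ := Finset.card_eq_two.1 hc
      have := hpair x (by simp) y (by simp) hxy
      have := hσ x (by simp)
      have := hσ y (by simp)
      rw [Finset.sum_pair hxy]
      nlinarith
    · obtain ⟨x, y, z, hxy, hxz, hyz, rfl⟩ := Finset.card_eq_three.1 hc
      have e1 := hpair x (by simp) y (by simp) hxy
      have e2 := hpair x (by simp) z (by simp) hxz
      have e3 := hpair y (by simp) z (by simp) hyz
      have f1 := hσ x (by simp)
      have f2 := hσ y (by simp)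
      have f3 := hσ z (by simp)
      rw [Finset.sum_insert (by simp [hxy, hxz]), Finset.sum_pair hyz]
      rcases le_total (σ x) (σ y) with h | h
      · rcases le_total (σ y) (σ z) with h' | h'
        · have := three_aux ρ (σ z) (σ x) (σ y) f3 f1 f2 (by linarith) (by linarith) (by linarith) h'
          linarith
        · have := three_aux ρ (σ y) (σ x) (σ z) f2 f1 f3 (by linarith) (by linarith) (by linarith) h'
          linarith
      · rcases le_total (σ x) (σ z) with h' | h'
        · have := three_aux ρ (σ z) (σ x) (σ y) f3 f1 f2 (by linarith) (by linarith) h' (by linarith)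
          linarith
        · have := three_aux ρ (σ x) (σ y) (σ z) f1 f2 f3 (by linarith) (by linarith) h (by linarith)
          linarith
  · have hc : (4 : ℤ) ≤ P.card := by exact_mod_cast (not_le.1 hP)
    set T := ∑ i ∈ P, σ i with hT
    set G := ∑ i ∈ P, g i with hG
    have hG0 : 0 ≤ G := Finset.sum_nonneg hg0
    have hρ1 : 1 ≤ ρ := by
      have : P.Nonempty := by
        rw [← Finset.card_pos]; omega
      obtain ⟨i, hi⟩ := this
      linarith [hσ i hi, hσρ i hi]
    have h1 : (P.card : ℤ) * (ν ^ 2 + 2 * ν) ≤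
        ∑ i ∈ P, (4 * (σ i * g i) + (ν - g i) * (ν - g i + 2) + 2 * ν * g i) := by
      rw [← nsmul_eq_mul]
      apply Finset.card_nsmul_le_sum
      intro i hi
      nlinarith [mul_nonneg (hg0 i hi) (sub_nonneg.2 (hσ i hi)), hg0 i hi, sq_nonneg (g i)]
    have h2 : 4 * ν * T + 4 * (ν ^ 2 + 2 * ν) - 2 * ν * G + 8 ≤ 4 * (ν * (ν + 1) + 2 * ν * ρ) := by
      have h3 : ∑ i ∈ P, (4 * ν * σ i + 4 * (σ i * g i) + (ν - g i) * (ν - g i + 2)) =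
        4 * ν * T + ∑ i ∈ P, (4 * (σ i * g i) + (ν - g i) * (ν - g i + 2) + 2 * ν * g i)
          - 2 * ν * G := by
        rw [hT, hG, Finset.mul_sum, Finset.mul_sum, ← Finset.sum_add_distrib,
          ← Finset.sum_sub_distrib]
        apply Finset.sum_congr rfl
        intro i _
        ring
      have h4 : 4 * (ν ^ 2 + 2 * ν) ≤ (P.card : ℤ) * (ν ^ 2 + 2 * ν) :=
        mul_le_mul_of_nonneg_right hc (by positivity)
      linarith
    have h5 : 2 * T < 4 * ρ - 2 + G := by
      by_contra hcon
      push Not at hcon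
      nlinarith [mul_le_mul_of_nonneg_left hcon (by linarith : (0:ℤ) ≤ ν)]
    by_cases hbig : ∀ i ∈ P, 2 * σ i ≤ ρ
    · have h6 : 2 * ∑ i ∈ P, σ i * (σ i + 1 - 2 * g i) ≤ (ρ + 2) * T - 2 * ρ * G := by
        rw [hT, hG, Finset.mul_sum, Finset.mul_sum, Finset.mul_sum, ← Finset.sum_sub_distrib]
        apply Finset.sum_le_sum
        intro i hi
        nlinarith [mul_nonneg (sub_nonneg.2 (hbig i hi)) (sub_nonneg.2 (hg i hi))]
      rcases hG0.eq_or_lt with h0 | h0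
      · have : T ≤ 2 * ρ - 2 := by omega
        rw [← h0] at h6
        nlinarith
      · have : 2 * T ≤ 4 * ρ - 3 + G := by omega
        nlinarith
    · push Not at hbig
      obtain ⟨k, hk, hka⟩ := hbig
      set a := σ k with haa
      obtain ⟨b, hb⟩ : ∃ b, b = ρ - a := ⟨_, rfl⟩
      have hoth : ∀ j ∈ P.erase k, σ j ≤ b := by
        intro j hj
        rw [Finset.mem_erase] at hj
        have := hpair j hj.2 k hk hj.1
        linarith
      have hb1 : 1 ≤ b := by
        have : (P.erase k).Nonempty := by
          rw [← Finset.card_pos, Finset.card_erase_of_mem hk]; omega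
        obtain ⟨j, hj⟩ := this
        exact (hσ j (Finset.mem_of_mem_erase hj)).trans (hoth j hj)
      have h6 : ∑ i ∈ P.erase k, σ i * (σ i + 1 - 2 * g i) ≤
          (b + 1) * ∑ i ∈ P.erase k, σ i - 2 * b * ∑ i ∈ P.erase k, g i := by
        rw [Finset.mul_sum, Finset.mul_sum, ← Finset.sum_sub_distrib]
        apply Finset.sum_le_sum
        intro i hi
        nlinarith [mul_nonneg (sub_nonneg.2 (hoth i hi)) (sub_nonneg.2 (hg i (Finset.mem_of_mem_erase hi)))]
      have e1 := Finset.add_sum_erase P σ hk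
      have e2 := Finset.add_sum_erase P g hk
      have e3 := Finset.add_sum_erase P (fun i => σ i * (σ i + 1 - 2 * g i)) hk
      rw [← hT] at e1
      rw [← hG] at e2
      have e1' : ∑ i ∈ P.erase k, σ i = T - a := by linarith
      have e2' : ∑ i ∈ P.erase k, g i = G - g k := by linarith
      rw [e1', e2'] at h6
      rw [← e3]
      have hgk := hg0 k hk
      simp only [← haa]
      have h7 : a * (a + 1 - 2 * g k) + ∑ i ∈ P.erase k, σ i * (σ i + 1 - 2 * g i) ≤
        a * (a + 1) + (b + 1) * (T - a) - 2 * b * G := by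
        nlinarith [mul_nonneg hgk (by linarith : 0 ≤ a - b)]
      refine h7.trans ?_
      obtain rfl : ρ = a + b := by linarith
      have h8 : 0 ≤ (a - b) * (b - 1) := mul_nonneg (by linarith) (by linarith)
      rcases hG0.eq_or_lt with h0 | h0
      · have : T ≤ 2 * (a + b) - 2 := by omega
        rw [← h0]
        nlinarith
      · have : 2 * T ≤ 4 * (a + b) - 3 + G := by omega
        have h9 : (b + 1) * (2 * T) ≤ (b + 1) * (4 * (a + b) - 3 + G) :=
          mul_le_mul_of_nonneg_left this (by linarith)
        nlinarith [mul_nonneg (by linarith : 0 ≤ G - 1) (by linarith : 0 ≤ 3 * b - 1)]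

theorem numeric_main {ι : Type*} [Fintype ι] [DecidableEq ι] (ν ρ : ℤ) (σ δ : ι → ℤ)
    (hν : 1 ≤ ν) (hρ : 0 ≤ ρ) (hσ : ∀ i, 0 ≤ σ i) (hδ : ∀ i, 0 ≤ δ i)
    (h2 : ∀ i, 2 * δ i ≤ ν) (hσρ : ∀ i, σ i ≤ ρ)
    (hpair : ∀ i j, i ≠ j → σ i + σ j ≤ ρ)
    (ha : ∑ i, (2 * (σ i * (ν - δ i)) + δ i * (δ i + 1)) + 2 ≤ ν * (ν + 1) + 2 * ν * ρ) :
    ∑ i, (σ i + δ i) * (σ i + δ i + 1) < (ν + ρ) * (ν + ρ + 1) := by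
  classical
  let g : ι → ℤ := fun i => ν - 2 * δ i
  let P : Finset ι := Finset.univ.filter (fun i => 1 ≤ σ i ∧ 2 * g i ≤ σ i)
  have key := numeric_P P ν ρ σ g hν hρ (fun i hi => (Finset.mem_filter.1 hi).2.1)
    (fun i _ => by have := h2 i; simp only [g]; linarith)
    (fun i hi => (Finset.mem_filter.1 hi).2.2) (fun i _ => hσρ i)
    (fun i _ j _ h => hpair i j h) (by
      have h3 : ∑ i ∈ P, (4 * ν * σ i + 4 * (σ i * g i) + (ν - g i) * (ν - g i + 2)) ≤
          ∑ i, (4 * ν * σ i + 4 * (σ i * g i) + (ν - g i) * (ν - g i + 2)) := by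
        apply Finset.sum_le_sum_of_subset_of_nonneg (Finset.subset_univ _)
        intro i _ _
        have a1 := hσ i
        have a2 := hδ i
        have a3 := h2 i
        have a4 : 0 ≤ g i := by simp only [g]; linarith
        have a5 : ν - g i = 2 * δ i := by simp only [g]; ring
        rw [a5]
        positivity
      have h4 : ∑ i, (4 * ν * σ i + 4 * (σ i * g i) + (ν - g i) * (ν - g i + 2)) =
          4 * ∑ i, (2 * (σ i * (ν - δ i)) + δ i * (δ i + 1)) := by
        rw [Finset.mul_sum]
        apply Finset.sum_congr rfl
        intro i _
        simp only [g]
        ring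
      linarith)
  have h5 : ∑ i, σ i * (σ i + 1 - 2 * g i) ≤ ∑ i ∈ P, σ i * (σ i + 1 - 2 * g i) := by
    rw [← Finset.sum_filter_add_sum_filter_not Finset.univ (fun i => 1 ≤ σ i ∧ 2 * g i ≤ σ i)]
    have : ∑ i ∈ Finset.univ.filter (fun i => ¬ (1 ≤ σ i ∧ 2 * g i ≤ σ i)),
        σ i * (σ i + 1 - 2 * g i) ≤ 0 := by
      apply Finset.sum_nonpos
      intro i hi
      have hi := (Finset.mem_filter.1 hi).2
      have a1 := hσ i
      rcases a1.eq_or_lt with h | h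
      · rw [← h]; simp
      · have : σ i < 2 * g i := by
          by_contra hh
          exact hi ⟨by omega, by omega⟩
        nlinarith
    simp only [P]
    linarith
  have h6 : ∑ i, (σ i + δ i) * (σ i + δ i + 1) = ∑ i, σ i * (σ i + 1 - 2 * g i) +
      ∑ i, (2 * (σ i * (ν - δ i)) + δ i * (δ i + 1)) := by
    rw [← Finset.sum_add_distrib]
    apply Finset.sum_congr rfl
    intro i _
    simp only [g]
    ring
  rw [h6]
  nlinarith
theorem two_mul_choose_two (k : ℕ) : 2 * (k + 1).choose 2 = k * (k + 1) := by
  induction k with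
  | zero => simp
  | succ k ih =>
    rw [Nat.choose_succ_succ' (k + 1) 1, mul_add, ih, Nat.choose_one_right]
    ring

theorem core_false {V : Type} [AddCommGroup V] [Module ℂ V] [FiniteDimensional ℂ V]
    {ι : Type} [Fintype ι] [DecidableEq ι] (L : ι → Type) [∀ i, AddCommGroup (L i)]
    [∀ i, Module ℂ (L i)] [∀ i, FiniteDimensional ℂ (L i)]
    (B : V →ₗ[ℂ] V →ₗ[ℂ] ℂ) (hB : ∀ a b, B a b = B b a) (hB0 : B ≠ 0)
    (X : ∀ i, L i →ₗ[ℂ] V) (hX : ∀ i, Function.Injective (X i))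
    (hdisj : ∀ i j, i ≠ j → Disjoint (LinearMap.range (X i)) (LinearMap.range (X j)))
    (hiso : ∀ i a b, B (X i a) (X i b) = 0)
    (D : (∀ i, L i →ₗ[ℂ] V) →ₗ[ℂ] (V →ₗ[ℂ] V →ₗ[ℂ] ℂ))
    (hDs : ∀ M a b, D M a b = D M b a)
    (h2 : ∀ M i a b, B (M i a) (X i b) + D M (X i a) (X i b) + B (X i a) (M i b) = 0)
    (h3 : ∀ M x y, B x = 0 → B y = 0 → D M x y = 0)
    (h4 : ∀ M i a, B (X i a) = 0 → ∃ b, D M (X i a) + B (M i a) + B (X i b) = 0)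
    (hN : Module.finrank ℂ V * (Module.finrank ℂ V + 1) ≤
      ∑ i, Module.finrank ℂ (L i) * (Module.finrank ℂ (L i) + 1)) : False := by
  obtain ⟨U, hU⟩ := Submodule.exists_isCompl (LinearMap.ker B)
  choose C hC using fun i => Submodule.exists_isCompl (LinearMap.ker (B ∘ₗ X i))
  have key := core_ineq L B hB hB0 X hiso D hDs h2 h3 h4 C hC U hU
  set ν := Module.finrank ℂ U with hν
  set ρ := Module.finrank ℂ (LinearMap.ker B) with hρ
  have hNN : ρ + ν = Module.finrank ℂ V := Submodule.finrank_add_eq_of_isCompl hU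
  have hdd : ∀ i, Module.finrank ℂ (LinearMap.ker (B ∘ₗ X i)) + Module.finrank ℂ (C i) =
      Module.finrank ℂ (L i) := fun i => Submodule.finrank_add_eq_of_isCompl (hC i)
  have hmap : ∀ i, Module.finrank ℂ (LinearMap.ker (B ∘ₗ X i)) =
      Module.finrank ℂ (LinearMap.range (X i) ⊓ LinearMap.ker B : Submodule ℂ V) := by
    intro i
    rw [← Submodule.map_comap_eq, ← LinearMap.ker_comp]
    exact (Submodule.equivMapOfInjective (X i) (hX i) _).finrank_eq
  have hrange : ∀ i, Module.finrank ℂ (LinearMap.range (X i)) = Module.finrank ℂ (L i) :=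
    fun i => LinearMap.finrank_range_of_inj (hX i)
  have hquot : ∀ i, Module.finrank ℂ (V ⧸ (LinearMap.range (X i) ⊔ LinearMap.ker B)) +
      Module.finrank ℂ (C i) = ν := by
    intro i
    have e1 := Submodule.finrank_quotient_add_finrank (LinearMap.range (X i) ⊔ LinearMap.ker B)
    have e2 := Submodule.finrank_sup_add_finrank_inf_eq (LinearMap.range (X i)) (LinearMap.ker B)
    have e3 := hmap i
    have e4 := hrange i
    have e5 := hdd i
    omega
  have h2δ : ∀ i, 2 * Module.finrank ℂ (C i) ≤ ν := by
    intro i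
    have e1 : Module.finrank ℂ (C i) ≤
        Module.finrank ℂ (LinearMap.range (X i) ⊔ LinearMap.ker B).dualAnnihilator := by
      let β : C i →ₗ[ℂ] (LinearMap.range (X i) ⊔ LinearMap.ker B).dualAnnihilator :=
        LinearMap.codRestrict _ (B ∘ₗ X i ∘ₗ (C i).subtype) (by
          intro c
          rw [Submodule.mem_dualAnnihilator]
          intro w hw
          obtain ⟨_, ⟨a, rfl⟩, r, hr, rfl⟩ := Submodule.mem_sup.1 hw
          have hr' : B r = 0 := hr
          simp [hiso, hB _ r, hr'])
      apply LinearMap.finrank_le_finrank_of_injective (f := β)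
      rw [← LinearMap.ker_eq_bot, LinearMap.ker_eq_bot']
      intro c hc
      have h1 : (c : L i) ∈ LinearMap.ker (B ∘ₗ X i) := congrArg Subtype.val hc
      exact Subtype.ext (Submodule.disjoint_def.1 (hC i).disjoint c h1 c.2)
    have e2 := Subspace.finrank_add_finrank_dualAnnihilator_eq
      (LinearMap.range (X i) ⊔ LinearMap.ker B)
    have e3 := Submodule.finrank_quotient_add_finrank (LinearMap.range (X i) ⊔ LinearMap.ker B)
    have e4 := hquot i
    omega
  have hσρ : ∀ i, Module.finrank ℂ (LinearMap.ker (B ∘ₗ X i)) ≤ ρ := by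
    intro i
    rw [hmap]
    exact Submodule.finrank_mono inf_le_right
  have hpair : ∀ i j, i ≠ j → Module.finrank ℂ (LinearMap.ker (B ∘ₗ X i)) +
      Module.finrank ℂ (LinearMap.ker (B ∘ₗ X j)) ≤ ρ := by
    intro i j hij
    rw [hmap, hmap, ← Submodule.finrank_sup_add_finrank_inf_eq]
    have : (LinearMap.range (X i) ⊓ LinearMap.ker B) ⊓ (LinearMap.range (X j) ⊓ LinearMap.ker B)
        = ⊥ := by
      rw [← disjoint_iff]
      exact (hdisj i j hij).mono inf_le_left inf_le_left
    rw [this, finrank_bot, add_zero]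
    exact Submodule.finrank_mono (sup_le inf_le_right inf_le_right)
  have hν1 : 1 ≤ ν := by
    by_contra hcon
    have h0 : ρ = Module.finrank ℂ V := by omega
    have := Submodule.eq_top_of_finrank_eq h0
    exact hB0 (LinearMap.ker_eq_top.1 this)
  have num := numeric_main (ν : ℤ) (ρ : ℤ)
    (fun i => (Module.finrank ℂ (LinearMap.ker (B ∘ₗ X i)) : ℤ))
    (fun i => (Module.finrank ℂ (C i) : ℤ)) (by exact_mod_cast hν1) (by positivity)
    (fun i => by positivity) (fun i => by positivity) (fun i => by exact_mod_cast h2δ i)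
    (fun i => by exact_mod_cast hσρ i) (fun i j hij => by exact_mod_cast hpair i j hij) (by
      have e1 : ∀ i, (ν : ℤ) - (Module.finrank ℂ (C i) : ℤ) =
        (Module.finrank ℂ (V ⧸ (LinearMap.range (X i) ⊔ LinearMap.ker B)) : ℤ) := by
        intro i
        have := hquot i
        omega
      have e2 : ∀ k : ℕ, (k : ℤ) * (k + 1) = 2 * ((k + 1).choose 2 : ℕ) := by
        intro k
        exact_mod_cast (two_mul_choose_two k).symm
      simp only [e1, e2]
      have key' : ((∑ i, (Module.finrank ℂ (LinearMap.ker (B ∘ₗ X i)) *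
        Module.finrank ℂ (V ⧸ (LinearMap.range (X i) ⊔ LinearMap.ker B)) +
        (Module.finrank ℂ (C i) + 1).choose 2) + 1 : ℕ) : ℤ) ≤ (ν * ρ + (ν + 1).choose 2 : ℕ) := by
        exact_mod_cast key
      push_cast at key'
      rw [← Finset.sum_congr rfl (fun i _ => mul_add (2:ℤ) _ _), ← Finset.mul_sum]
      linarith)
  have hN' : ((Module.finrank ℂ V : ℤ)) * (Module.finrank ℂ V + 1) ≤
      ∑ i, (Module.finrank ℂ (L i) : ℤ) * (Module.finrank ℂ (L i) + 1) := by exact_mod_cast hN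
  rw [← hNN] at hN'
  simp only [← hdd] at hN'
  push_cast at hN'
  rw [add_comm (ν : ℤ) ρ] at num
  linarith


open TensorProduct in
theorem exists_derivation_of_trBasis {t : Type} (x : t → ℂ) (hx : IsTranscendenceBasis ℚ x) (f : t → ℂ) :
    ∃ D : Derivation ℚ ℂ ℂ, ∀ k, D (x k) = f k := by
  classical
  let A := MvPolynomial t ℚ
  let : Algebra A ℂ := (MvPolynomial.aeval x : A →ₐ[ℚ] ℂ).toRingHom.toAlgebra
  have hmap : ∀ p : A, algebraMap A ℂ p = MvPolynomial.aeval x p := fun p => rfl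
  have : IsScalarTower ℚ A ℂ := IsScalarTower.of_algebraMap_eq (fun r => by
    rw [hmap, MvPolynomial.algebraMap_eq, MvPolynomial.aeval_C])
  have : FaithfulSMul A ℂ := (faithfulSMul_iff_algebraMap_injective A ℂ).2 hx.1
  let K := FractionRing A
  let : Algebra K ℂ := FractionRing.liftAlgebra A ℂ
  have : IsScalarTower A K ℂ := FractionRing.isScalarTower_liftAlgebra A ℂ
  have : Algebra.IsAlgebraic A ℂ := by
    have h := hx.isAlgebraic
    refine ⟨fun z => ?_⟩
    obtain ⟨p, hp, hz⟩ := h.isAlgebraic z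
    let e := hx.1.aevalEquiv
    refine ⟨p.map e.symm.toRingEquiv.toRingHom, ?_, ?_⟩
    · rw [Ne, Polynomial.map_eq_zero_iff]
      · exact hp
      · exact e.symm.injective
    · have hcomp : (algebraMap A ℂ).comp e.symm.toRingEquiv.toRingHom =
          (Algebra.adjoin ℚ (Set.range x)).val.toRingHom := by
        apply RingHom.ext
        intro y
        obtain ⟨q, rfl⟩ := e.surjective y
        change (algebraMap A ℂ) (e.symm (e q)) = ((e q : Algebra.adjoin ℚ (Set.range x)) : ℂ)
        rw [e.symm_apply_apply, hmap]
        exact (hx.1.algebraMap_aevalEquiv q).symm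
      rw [Polynomial.aeval_def] at hz ⊢
      refine (Polynomial.eval₂_map _ _ _).trans ?_
      rw [hcomp]
      exact hz
  have : Algebra.IsAlgebraic K ℂ := (IsFractionRing.comap_isAlgebraic_iff (A := A)).1 inferInstance
  have : CharZero K := charZero_of_injective_algebraMap (IsFractionRing.injective A K)
  have : Algebra.FormallyEtale K ℂ := Algebra.FormallyEtale.of_isSeparable K ℂ
  have : Algebra.FormallyEtale A K := Algebra.FormallyEtale.of_isLocalization (nonZeroDivisors A)
  have : Algebra.FormallyEtale A ℂ := Algebra.FormallyEtale.comp A K ℂ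
  let d0 : Derivation ℚ A ℂ := MvPolynomial.mkDerivation ℚ f
  let l := LinearMap.liftBaseChange ℂ d0.liftKaehlerDifferential
  let e := KaehlerDifferential.tensorKaehlerEquivOfFormallyEtale ℚ A ℂ
  refine ⟨(l ∘ₗ e.symm.toLinearMap).compDer (KaehlerDifferential.D ℚ ℂ), fun k => ?_⟩
  have : x k = algebraMap A ℂ (MvPolynomial.X k) := by simp [hmap]
  rw [this]
  simp [l, e, KaehlerDifferential.tensorKaehlerEquivOfFormallyEtale_symm_D_algebraMap, d0,
    -MvPolynomial.aeval_X]
  exact MvPolynomial.mkDerivation_X ℚ f k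
  

theorem exists_generic (κ : Type) [Finite κ] : ∃ x : κ → ℂ, AlgebraicIndependent ℚ x ∧
    ∀ f : κ → ℂ, ∃ D : Derivation ℚ ℂ ℂ, ∀ k, D (x k) = f k := by
  classical
  obtain ⟨t, ht⟩ := exists_isTranscendenceBasis ℚ ℂ
  have hc := IsAlgClosed.cardinal_eq_cardinal_transcendence_basis_of_aleph0_lt' _ ht
    (by simp) (by rw [Cardinal.mk_complex]; exact Cardinal.aleph0_lt_continuum)
  have : Infinite t := by
    rw [Cardinal.infinite_iff, ← hc, Cardinal.mk_complex]; exact Cardinal.aleph0_le_continuum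
  obtain ⟨n, ⟨e⟩⟩ := Finite.exists_equiv_fin κ
  let g : κ ↪ t := e.toEmbedding.trans (Fin.valEmbedding.trans (Infinite.natEmbedding t))
  refine ⟨fun k => (g k : ℂ), ht.1.comp g g.injective, fun f => ?_⟩
  obtain ⟨D, hD⟩ := exists_derivation_of_trBasis _ ht (Function.extend g f 0)
  exact ⟨D, fun k => by rw [hD, g.injective.extend_apply]⟩

theorem generic_cols {N : ℕ} {ι : Type} (d : ι → ℕ)
    (x : (Σ i, Fin N × Fin (d i)) → ℂ) (hx : AlgebraicIndependent ℚ x)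
    {S : Type} [Fintype S] [DecidableEq S] (e : S → Fin N) (he : Function.Injective e)
    (φ : S → Σ i, Fin (d i)) (hφ : Function.Injective φ) (a : S → ℂ)
    (ha : ∀ r, ∑ q, x ⟨(φ q).1, r, (φ q).2⟩ * a q = 0) : a = 0 := by
  let A : Matrix S S ℂ := Matrix.of fun p q => x ⟨(φ q).1, e p, (φ q).2⟩
  have hA : A.det ≠ 0 := by
    let ψ : S × S → Σ i, Fin N × Fin (d i) := fun p => ⟨(φ p.2).1, e p.1, (φ p.2).2⟩
    have hψ : Function.Injective ψ := by
      rintro ⟨p, q⟩ ⟨p', q'⟩ h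
      let π1 : (Σ i, Fin N × Fin (d i)) → Fin N := fun z => z.2.1
      let π2 : (Σ i, Fin N × Fin (d i)) → Σ i, Fin (d i) := fun z => ⟨z.1, z.2.2⟩
      have h1 : e p = e p' := congrArg π1 h
      have h2 : φ q = φ q' := congrArg π2 h
      rw [he h1, hφ h2]
    have hind := hx.comp ψ hψ
    have hinj : Function.Injective (MvPolynomial.aeval (x ∘ ψ) : MvPolynomial (S × S) ℚ →ₐ[ℚ] ℂ) :=
      hind
    intro h0
    have e1 := Matrix.mvPolynomialX_mapMatrix_aeval ℚ A
    have e2 : (MvPolynomial.aeval fun p : S × S => A p.1 p.2 : MvPolynomial (S × S) ℚ →ₐ[ℚ] ℂ)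
        (Matrix.det (Matrix.mvPolynomialX S S ℚ)) = 0 := by
      rw [AlgHom.map_det, e1, h0]
    have e3 : (MvPolynomial.aeval (x ∘ ψ) : MvPolynomial (S × S) ℚ →ₐ[ℚ] ℂ)
        (Matrix.det (Matrix.mvPolynomialX S S ℚ)) = 0 := e2
    exact Matrix.det_mvPolynomialX_ne_zero S ℚ (hinj (e3.trans (map_zero _).symm))
  apply Matrix.eq_zero_of_mulVec_eq_zero hA
  ext p
  exact ha (e p)

theorem theoremZ (N : ℕ) {ι : Type} [Fintype ι] [DecidableEq ι] (d : ι → ℕ)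
    (hd : ∀ i, d i ≤ N) (hdd : ∀ i j, i ≠ j → d i + d j ≤ N)
    (hN : N * (N + 1) ≤ ∑ i, d i * (d i + 1)) :
    ∃ X : ∀ i, (Fin (d i) → ℂ) →ₗ[ℂ] (Fin N → ℂ), (∀ i, Function.Injective (X i)) ∧
      (∀ i j, i ≠ j → Disjoint (LinearMap.range (X i)) (LinearMap.range (X j))) ∧
      ∀ B : (Fin N → ℂ) →ₗ[ℂ] (Fin N → ℂ) →ₗ[ℂ] ℂ, (∀ a b, B a b = B b a) →
        (∀ i a b, B (X i a) (X i b) = 0) → B = 0 := by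
  obtain ⟨x, hx, hder⟩ := exists_generic (Σ i, Fin N × Fin (d i))
  let X : ∀ i, (Fin (d i) → ℂ) →ₗ[ℂ] (Fin N → ℂ) := fun i =>
    Matrix.toLin' (Matrix.of fun r c => x ⟨i, r, c⟩)
  have hXa : ∀ i a r, X i a r = ∑ c, x ⟨i, r, c⟩ * a c := fun i a r => rfl
  have hsig : ∀ i, Function.Injective (fun c : Fin (d i) => (⟨i, c⟩ : Σ i, Fin (d i))) :=
    fun i => sigma_mk_injective (β := fun i => Fin (d i))
  have hinj : ∀ i, Function.Injective (X i) := by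
    intro i
    rw [← LinearMap.ker_eq_bot, LinearMap.ker_eq_bot']
    intro a ha
    refine generic_cols d x hx (Fin.castLE (hd i)) (Fin.castLE_injective _) (fun c => ⟨i, c⟩)
      (hsig i) a (fun r => ?_)
    rw [← hXa, ha]; rfl
  have hdisj : ∀ i j, i ≠ j → Disjoint (LinearMap.range (X i)) (LinearMap.range (X j)) := by
    intro i j hij
    rw [Submodule.disjoint_def]
    rintro _ ⟨a, rfl⟩ ⟨b, hb⟩
    have := generic_cols d x hx (S := Fin (d i) ⊕ Fin (d j))
      (fun q => Fin.castLE (hdd i j hij) (finSumFinEquiv q))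
      (fun p q h => finSumFinEquiv.injective (Fin.castLE_injective _ h))
      (Sum.elim (fun c => ⟨i, c⟩) (fun c => ⟨j, c⟩))
      (Function.Injective.sumElim (hsig i) (hsig j) (by
        intro c c' h
        exact hij (congrArg Sigma.fst h)))
      (Sum.elim a (-b)) (fun r => by
        have h1 := congrFun hb r
        rw [hXa, hXa] at h1
        simp [Fintype.sum_sum_type, h1])
    have ha : a = 0 := by
      ext c
      exact congrFun this (Sum.inl c)
    rw [ha, map_zero]
  refine ⟨X, hinj, hdisj, fun B hB hiso => ?_⟩
  by_contra hB0
  choose del hdel using fun k => hder (Pi.single k 1)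
  let co : (∀ i, (Fin (d i) → ℂ) →ₗ[ℂ] (Fin N → ℂ)) → (Σ i, Fin N × Fin (d i)) → ℂ :=
    fun M k => M k.1 (Pi.single k.2.2 1) k.2.1
  let dM : (∀ i, (Fin (d i) → ℂ) →ₗ[ℂ] (Fin N → ℂ)) → Derivation ℚ ℂ ℂ :=
    fun M => ∑ k, co M k • del k
  have hdM_apply : ∀ M z, dM M z = ∑ k, co M k * del k z := by
    intro M z
    have h := congrFun (map_sum (Derivation.coeFnAddMonoidHom : Derivation ℚ ℂ ℂ →+ (ℂ → ℂ))
      (fun k => co M k • del k) Finset.univ) z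
    rw [Finset.sum_apply] at h
    exact h
  have hdMx : ∀ M k, dM M (x k) = co M k := by
    intro M k
    rw [hdM_apply, Finset.sum_eq_single k]
    · rw [hdel]; simp
    · intro l _ hl
      rw [hdel]; simp [hl.symm]
    · simp
  let F : (∀ i, (Fin (d i) → ℂ) →ₗ[ℂ] (Fin N → ℂ)) → Matrix (Fin N) (Fin N) ℂ :=
    fun M => Matrix.of fun r s => dM M (B (Pi.single r 1) (Pi.single s 1))
  let D : (∀ i, (Fin (d i) → ℂ) →ₗ[ℂ] (Fin N → ℂ)) →ₗ[ℂ]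
      ((Fin N → ℂ) →ₗ[ℂ] (Fin N → ℂ) →ₗ[ℂ] ℂ) :=
    { toFun := fun M => Matrix.toLinearMap₂' ℂ (F M)
      map_add' := by
        intro M M'
        rw [← map_add]
        congr 1
        ext r s
        simp only [F, Matrix.of_apply, Matrix.add_apply, hdM_apply, ← Finset.sum_add_distrib]
        refine Finset.sum_congr rfl fun k _ => ?_
        simp only [co, Pi.add_apply, LinearMap.add_apply]
        ring
      map_smul' := by
        intro c M
        rw [RingHom.id_apply, ← map_smul]
        congr 1
        ext r s
        simp only [F, Matrix.of_apply, Matrix.smul_apply, hdM_apply, smul_eq_mul, Finset.mul_sum]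
        refine Finset.sum_congr rfl fun k _ => ?_
        simp only [co, Pi.smul_apply, LinearMap.smul_apply, smul_eq_mul]
        ring }
  have hDapp : ∀ M v w, D M v w = ∑ r, ∑ s, v r * w s *
      dM M (B (Pi.single r 1) (Pi.single s 1)) := by
    intro M v w
    change Matrix.toLinearMap₂' ℂ (F M) v w = _
    rw [Matrix.toLinearMap₂'_apply]
    refine Finset.sum_congr rfl fun r _ => Finset.sum_congr rfl fun s _ => ?_
    simp only [F, Matrix.of_apply, smul_eq_mul]
    ring
  have hBapp : ∀ v w, B v w = ∑ r, ∑ s, v r * w s * B (Pi.single r 1) (Pi.single s 1) := by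
    intro v w
    conv_lhs => rw [pi_eq_sum_univ' v, pi_eq_sum_univ' w]
    simp only [map_sum, LinearMap.sum_apply, map_smul, LinearMap.smul_apply, smul_eq_mul,
      Finset.mul_sum]
    rw [Finset.sum_comm]
    refine Finset.sum_congr rfl fun r _ => Finset.sum_congr rfl fun s _ => ?_
    ring
  have leib : ∀ M v w, dM M (B v w) = B (fun r => dM M (v r)) w + B v (fun r => dM M (w r)) +
      D M v w := by
    intro M v w
    rw [hBapp v w, hBapp _ w, hBapp v, hDapp, map_sum, ← Finset.sum_add_distrib,
      ← Finset.sum_add_distrib]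
    refine Finset.sum_congr rfl fun r _ => ?_
    rw [map_sum, ← Finset.sum_add_distrib, ← Finset.sum_add_distrib]
    refine Finset.sum_congr rfl fun s _ => ?_
    rw [Derivation.leibniz, Derivation.leibniz]
    simp only [smul_eq_mul]
    ring
  have hXd : ∀ M i a, (fun r => dM M (X i a r)) = M i a + X i (fun c => dM M (a c)) := by
    intro M i a
    ext r
    rw [Pi.add_apply, hXa, hXa, map_sum]
    have e : M i a r = ∑ c, co M ⟨i, r, c⟩ * a c := by
      conv_lhs => rw [pi_eq_sum_univ' a]
      simp only [map_sum, Finset.sum_apply, map_smul, Pi.smul_apply, smul_eq_mul, co]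
      exact Finset.sum_congr rfl fun c _ => mul_comm _ _
    rw [e, ← Finset.sum_add_distrib]
    refine Finset.sum_congr rfl fun c _ => ?_
    rw [Derivation.leibniz, hdMx]
    simp only [smul_eq_mul]
    ring
  refine core_false (fun i => Fin (d i) → ℂ) B hB hB0 X hinj hdisj hiso D ?_ ?_ ?_ ?_ ?_
  · intro M a b
    rw [hDapp, hDapp, Finset.sum_comm]
    refine Finset.sum_congr rfl fun r _ => Finset.sum_congr rfl fun s _ => ?_
    rw [hB (Pi.single r 1)]
    ring
  · intro M i a b
    have h := leib M (X i a) (X i b)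
    rw [hiso, map_zero, hXd, hXd, map_add, map_add, LinearMap.add_apply, hiso, hiso] at h
    linear_combination -h
  · intro M v w hv hw
    have h := leib M v w
    rw [hB (fun r => dM M (v r)) w, hv, hw] at h
    simpa using h.symm
  · intro M i a ha
    refine ⟨fun c => dM M (a c), ?_⟩
    ext1 s
    rename_i s
    ext
    have h := leib M (X i a) (Pi.single s 1)
    rw [hXd, ha] at h
    simp only [LinearMap.zero_apply, map_zero, map_add, LinearMap.add_apply] at h
    simp only [LinearMap.comp_apply, LinearMap.add_apply, LinearMap.zero_apply,
      LinearMap.coe_single]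
    linear_combination -h
  · simpa using hN

theorem assoc_zero {V L : Type} [AddCommGroup V] [Module ℂ V] [AddCommGroup L] [Module ℂ L]
    (q : QuadraticForm ℂ V) (X : L →ₗ[ℂ] V) (h : ∀ a, q (X a) = 0) (a b : L) :
    QuadraticMap.associated (R := ℂ) q (X a) (X b) = 0 := by
  rw [QuadraticMap.associated_apply, ← map_add, h, h, h]
  simp

/-- A generic configuration of pairwise disjoint linear spaces of weight vector
`(m_1, …, m_s)` in `ℙ^n` has the expected number of quadrics through it:
`dim (I_Λ)_2 = max { C(n+2,2) - Σ C(m_i+2,2), 0 }`. -/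
theorem stmt4 (n s : ℕ) (m : ℕ → ℕ) (hs : 2 ≤ s)
    (hmono : ∀ i j, 1 ≤ i → i ≤ j → j ≤ s → m j ≤ m i)
    (h12 : m 1 + m 2 < n) :
    ∃ W : ℕ → Submodule ℂ (Fin (n + 1) → ℂ),
      (∀ i ∈ Finset.Icc 1 s, Module.finrank ℂ (W i) = m i + 1) ∧
      (∀ i ∈ Finset.Icc 1 s, ∀ j ∈ Finset.Icc 1 s, i ≠ j → W i ⊓ W j = ⊥) ∧
      (Module.finrank ℂ (quadVanishing n s W) : ℤ) =
        max (((n + 2).choose 2 : ℤ) - ∑ i ∈ Finset.Icc 1 s, ((m i + 2).choose 2 : ℤ)) 0 := by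
  classical
  let e : ℕ := (n + 2).choose 2 - ∑ i ∈ Finset.Icc 1 s, (m i + 2).choose 2
  let d : (Finset.Icc 1 s) ⊕ Fin e → ℕ := Sum.elim (fun i => m i + 1) (fun _ => 1)
  have hpair : ∀ i j, 1 ≤ i → i < j → j ≤ s → m i + m j < n := by
    intro i j hi hij hj
    have h1 := hmono 1 i le_rfl hi (by omega)
    have h2 := hmono 2 j (by omega) (by omega) hj
    omega
  have hone : ∀ i, 1 ≤ i → i ≤ s → m i < n := by
    intro i hi hj
    have h1 := hmono 1 i le_rfl hi (by omega)
    omega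
  have hsum : ∑ i : (Finset.Icc 1 s), (m i + 2).choose 2 =
      ∑ i ∈ Finset.Icc 1 s, (m i + 2).choose 2 :=
    Finset.sum_coe_sort (Finset.Icc 1 s) (fun i => (m i + 2).choose 2)
  obtain ⟨X, hinj, hdisj, hzero⟩ := theoremZ (n + 1) d (by
      rintro (⟨i, hi⟩ | k)
      · have := Finset.mem_Icc.1 hi
        have := hone i this.1 this.2
        change m i + 1 ≤ n + 1
        omega
      · change 1 ≤ n + 1
        omega) (by
      rintro (⟨i, hi⟩ | k) (⟨j, hj⟩ | l) hij
      · rw [Finset.mem_Icc] at hi hj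
        change m i + 1 + (m j + 1) ≤ n + 1
        have hne : i ≠ j := by
          rintro rfl
          exact hij rfl
        rcases lt_or_gt_of_ne hne with h | h
        · have := hpair i j hi.1 h hj.2
          omega
        · have := hpair j i hj.1 h hi.2
          omega
      · have := Finset.mem_Icc.1 hi
        have := hone i this.1 this.2
        change m i + 1 + 1 ≤ n + 1
        omega
      · have := Finset.mem_Icc.1 hj
        have := hone j this.1 this.2
        change 1 + (m j + 1) ≤ n + 1
        omega
      · change 1 + 1 ≤ n + 1
        omega) (by
      rw [Fintype.sum_sum_type]
      change _ ≤ ∑ i : (Finset.Icc 1 s), (m i + 1) * (m i + 1 + 1) + ∑ i : Fin e, 1 * (1 + 1)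
      simp only [← two_mul_choose_two]
      rw [← Finset.mul_sum, hsum]
      simp only [Finset.sum_const, Finset.card_univ, Fintype.card_fin, smul_eq_mul]
      simp only [e]
      have h11 : (1 + 1 : ℕ).choose 2 = 1 := rfl
      rw [h11]
      change 2 * (n + 2).choose 2 ≤ _
      generalize ∑ i ∈ Finset.Icc 1 s, (m i + 2).choose 2 = S
      omega)
  let W : ℕ → Submodule ℂ (Fin (n + 1) → ℂ) := fun k =>
    if h : k ∈ Finset.Icc 1 s then LinearMap.range (X (Sum.inl ⟨k, h⟩)) else ⊥
  have hW : ∀ k (h : k ∈ Finset.Icc 1 s), W k = LinearMap.range (X (Sum.inl ⟨k, h⟩)) :=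
    fun k h => dif_pos h
  refine ⟨W, ?_, ?_, ?_⟩
  · intro i hi
    rw [hW i hi, LinearMap.finrank_range_of_inj (hinj _)]
    exact Module.finrank_fin_fun (n := m i + 1) ℂ
  · intro i hi j hj hij
    rw [hW i hi, hW j hj, ← disjoint_iff]
    apply hdisj
    intro h
    exact hij (congrArg Subtype.val (Sum.inl.inj h))
  · -- upper bound
    let ev : quadVanishing n s W →ₗ[ℂ] (Fin e → ℂ) :=
      { toFun := fun q k => q.1 (X (Sum.inr k) (fun _ => 1))
        map_add' := fun q q' => rfl
        map_smul' := fun c q => rfl }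
    have hev : Function.Injective ev := by
      intro q q' hqq
      let p : QuadraticForm ℂ (Fin (n + 1) → ℂ) := q.1 - q'.1
      have hp : ∀ v, p v = q.1 v - q'.1 v := fun v => rfl
      have hB : QuadraticMap.associated (R := ℂ) p = 0 := by
        apply hzero
        · intro a b
          rw [QuadraticMap.associated_apply, QuadraticMap.associated_apply, add_comm a b]
          congr 1
          ring
        · intro i a b
          apply assoc_zero
          intro a
          rcases i with ⟨i, hi⟩ | k
          · have hmem : X (Sum.inl ⟨i, hi⟩) a ∈ W i := by
              rw [hW i hi]
              exact ⟨a, rfl⟩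
            rw [hp, q.2 i hi _ hmem, q'.2 i hi _ hmem, sub_zero]
          · have h1 : a = (a (0 : Fin 1)) • (fun _ => (1 : ℂ)) := by
              ext c
              have : c = (0 : Fin 1) := Subsingleton.elim (α := Fin 1) _ _
              rw [this]
              exact (mul_one _).symm
            have h2 : p (X (Sum.inr k) (fun _ => 1)) = 0 := by
              rw [hp]
              exact sub_eq_zero.2 (congrFun hqq k)
            rw [h1, map_smul, QuadraticMap.map_smul, h2, smul_zero]
      apply Subtype.ext
      ext v
      have h3 : p v = 0 := by
        rw [← QuadraticMap.associated_eq_self_apply ℂ p v, hB]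
        rfl
      exact sub_eq_zero.1 h3
    have hfd : FiniteDimensional ℂ (quadVanishing n s W) := FiniteDimensional.of_injective ev hev
    have hup : Module.finrank ℂ (quadVanishing n s W) ≤ e := by
      have := LinearMap.finrank_le_finrank_of_injective hev
      simpa using this
    -- lower bound
    let T : SymB (Fin (n + 1) → ℂ) →ₗ[ℂ]
        (∀ i : (Finset.Icc 1 s), SymB (Fin (d (Sum.inl i)) → ℂ)) :=
      { toFun := fun E i => ⟨E.1.compl₁₂ (X (Sum.inl i)) (X (Sum.inl i)), fun a b => E.2 _ _⟩
        map_add' := fun E F => rfl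
        map_smul' := fun c E => rfl }
    let J : LinearMap.ker T →ₗ[ℂ] quadVanishing n s W :=
      { toFun := fun E => ⟨LinearMap.BilinMap.toQuadraticMap E.1.1, by
          intro i hi v hv
          rw [hW i hi] at hv
          obtain ⟨a, rfl⟩ := hv
          have h1 : T E.1 = 0 := E.2
          have h2 := congrArg Subtype.val (congrFun h1 ⟨i, hi⟩)
          exact LinearMap.congr_fun (LinearMap.congr_fun h2 a) a⟩
        map_add' := fun E F => rfl
        map_smul' := fun c E => rfl }
    have hJ : Function.Injective J := by
      intro E F h
      apply Subtype.ext
      apply Subtype.ext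
      have h0 : ∀ v, E.1.1 v v = F.1.1 v v := by
        intro v
        exact congrArg (fun q : quadVanishing n s W => q.1 v) h
      refine LinearMap.ext fun r => LinearMap.ext fun v => ?_
      have h1 := h0 (r + v)
      have h2 := h0 r
      have h3 := h0 v
      have h4 := E.1.2 r v
      have h5 := F.1.2 r v
      simp only [map_add, LinearMap.add_apply] at h1
      linear_combination (1 / 2) * (h1 - h2 - h3) + (1 / 2) * h4 - (1 / 2) * h5
    have hlow := LinearMap.finrank_le_finrank_of_injective hJ
    have hrn := LinearMap.finrank_range_add_finrank_ker T
    have hr := Submodule.finrank_le (LinearMap.range T)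
    rw [finrank_SymB] at hrn
    have hpi : Module.finrank ℂ (∀ i : (Finset.Icc 1 s), SymB (Fin (d (Sum.inl i)) → ℂ)) =
        ∑ i ∈ Finset.Icc 1 s, (m i + 2).choose 2 := by
      rw [Module.finrank_pi_fintype, ← hsum]
      refine Finset.sum_congr rfl fun i _ => ?_
      rw [finrank_SymB]
      have h1 : Module.finrank ℂ (Fin (d (Sum.inl i)) → ℂ) = m i + 1 :=
        Module.finrank_fin_fun (n := m i + 1) ℂ
      rw [h1]
    rw [hpi] at hr
    rw [Module.finrank_fin_fun] at hrn
    have hcast : (∑ i ∈ Finset.Icc 1 s, ((m i + 2).choose 2 : ℤ)) =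
      ((∑ i ∈ Finset.Icc 1 s, (m i + 2).choose 2 : ℕ) : ℤ) := by push_cast; rfl
    rw [hcast]
    simp only [e] at hup
    have hc : (n + 1 + 1).choose 2 = (n + 2).choose 2 := rfl
    rw [hc] at hrn
    generalize ∑ i ∈ Finset.Icc 1 s, (m i + 2).choose 2 = S at *
    omega
end

section
/- Let s ≥ 2 and m_1 ≥ m_2 ≥ … ≥ m_s ≥ 0 be integers with m_1 + m_2 < n and Σ_{i=1}^s C(m_i+2,2) ≥ C(n+2,2). Then there exist subspaces U_1, …, U_s of the space T_1 of linear forms in y_0,…,y_n with dim U_i = m_i + 1 such that every quadratic form in T_2 can be written as q_1 + … + q_s, where each q_i lies in the linear span of the products u·v with u, v ∈ U_i. Equivalently, for a generic choice of linear forms l_{i,0},…,l_{i,m_i} (i = 1,…,s), every quadratic form f(y_0,…,y_n) can be written as f_1(l_{1,0},…,l_{1,m_1}) + … + f_s(l_{s,0},…,l_{s,m_s}) for suitable quadratic forms f_i. -/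
/-- triangular numbers -/
def QTri (d : ℕ) : ℕ := (d + 1).choose 2

lemma QTri_two (d : ℕ) : 2 * QTri d = d * (d + 1) := by
  unfold QTri
  rw [Nat.choose_two_right, Nat.mul_div_cancel' , Nat.add_sub_cancel, mul_comm]
  have := Nat.even_mul_pred_self (d+1)
  exact this.two_dvd

lemma QTri_cast (d : ℕ) : (QTri d : ℝ) = d * (d + 1) / 2 := by
  have := QTri_two d
  have h : (2 : ℝ) * QTri d = d * (d + 1) := by exact_mod_cast this
  linarith

lemma QTri_mono {a b : ℕ} (h : a ≤ b) : QTri a ≤ QTri b := by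
  unfold QTri
  exact Nat.choose_le_choose 2 (by omega)

lemma QTri_succ (d : ℕ) : QTri (d + 1) = QTri d + (d + 1) := by
  have h1 := QTri_two d
  have h2 := QTri_two (d+1)
  nlinarith

/-- ratio bound, general `d ≤ D` with `h ≤ D`. -/
lemma ratio_bound (h D d : ℕ) (hD : h ≤ D) (hd : d ≤ D) :
    (h * (2 * D - h + 1) : ℝ) * QTri d ≤ (D * (D + 1) : ℝ) * ((QTri d : ℝ) - QTri (d - h)) := by
  rcases le_total d h with hdh | hdh
  · rw [Nat.sub_eq_zero_of_le hdh]
    have h0 : (QTri 0 : ℝ) = 0 := by simp [QTri]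
    rw [h0, sub_zero]
    have : (0:ℝ) ≤ QTri d := by positivity
    apply mul_le_mul_of_nonneg_right _ this
    have : (h:ℝ) ≤ D := by exact_mod_cast hD
    nlinarith [mul_self_nonneg ((D:ℝ) - h)]
  · obtain ⟨x, rfl⟩ := Nat.exists_eq_add_of_le hdh
    obtain ⟨y, rfl⟩ := Nat.exists_eq_add_of_le hd
    rw [Nat.add_sub_cancel_left, QTri_cast, QTri_cast]
    push_cast
    have hh : (0:ℝ) ≤ h := by positivity
    have hx : (0:ℝ) ≤ x := by positivity
    have hy : (0:ℝ) ≤ y := by positivity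
    have e : (((h + x + y : ℝ)) * ((h + x + y) + 1)) * ((h + x) * ((h + x) + 1) / 2 - x * (x + 1) / 2)
      - h * (2 * (h + x + y) - h + 1) * ((h + x) * ((h + x) + 1) / 2)
      = h * y * (2*x^2+2*h*x+2*x+h+1+y*h+2*x*y+y) / 2 := by
      ring
    rw [← sub_nonneg, e]
    positivity

/-- `T d - T (d - h)` as a real number. -/
noncomputable def QG (h d : ℕ) : ℝ := (QTri d : ℝ) - QTri (d - h)

lemma QG_nonneg (h d : ℕ) : 0 ≤ QG h d := by
  unfold QG
  have : (QTri (d - h) : ℝ) ≤ QTri d := by exact_mod_cast QTri_mono (Nat.sub_le d h)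
  linarith

lemma QG_eq (h d : ℕ) (hd : h ≤ d) : QG h d = h * (2 * d - h + 1) / 2 := by
  unfold QG
  obtain ⟨x, rfl⟩ := Nat.exists_eq_add_of_le hd
  rw [Nat.add_sub_cancel_left, QTri_cast, QTri_cast]
  push_cast
  ring

lemma ratio_sum {ι : Type*} (S : Finset ι) (d : ι → ℕ) (h D : ℕ) (hD : h ≤ D)
    (hd : ∀ i ∈ S, d i ≤ D) :
    (h * (2 * D - h + 1) : ℝ) * ∑ i ∈ S, (QTri (d i) : ℝ) ≤
      (D * (D + 1) : ℝ) * ∑ i ∈ S, QG h (d i) := by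
  rw [Finset.mul_sum, Finset.mul_sum]
  exact Finset.sum_le_sum fun i hi => ratio_bound h D (d i) hD (hd i hi)

lemma num_even {ι : Type*} [DecidableEq ι] (S : Finset ι) (d : ι → ℕ) (h D : ℕ)
    (h1 : 1 ≤ h) (hD : h < D) (hd : ∀ i ∈ S, d i ≤ D)
    (hS : (D : ℝ) ^ 2 ≤ ∑ i ∈ S, (QTri (d i) : ℝ)) :
    (h * (2 * D - h) : ℝ) ≤ ∑ i ∈ S, QG h (d i) := by
  obtain ⟨E, rfl⟩ : ∃ E, D = E + 1 := ⟨D - 1, by omega⟩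
  have hE : h ≤ E := by omega
  have hE' : (h : ℝ) ≤ E := by exact_mod_cast hE
  have h1' : (1 : ℝ) ≤ h := by exact_mod_cast h1
  have hEp : (0 : ℝ) < E * (E + 1) := by nlinarith
  by_cases hc : ∃ c ∈ S, d c = E + 1
  · obtain ⟨c, hcS, hc⟩ := hc
    rw [← Finset.add_sum_erase S _ hcS, hc] at hS ⊢
    rw [QG_eq h (E+1) (by omega)]
    rw [QTri_cast] at hS
    have hmain : (h * (2 * E - h + 1) / 2 : ℝ) ≤ ∑ i ∈ S.erase c, QG h (d i) := by
      by_cases hc2 : ∃ c' ∈ S.erase c, d c' = E + 1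
      · obtain ⟨c', hcS', hc'⟩ := hc2
        rw [← Finset.add_sum_erase _ _ hcS', hc', QG_eq h (E+1) (by omega)]
        have : 0 ≤ ∑ i ∈ (S.erase c).erase c', QG h (d i) :=
          Finset.sum_nonneg fun i _ => QG_nonneg _ _
        push_cast
        nlinarith
      · have := ratio_sum (S.erase c) d h E hE (fun i hi => by
          have h3 := hd i (Finset.mem_of_mem_erase hi)
          have h4 : d i ≠ E + 1 := fun h5 => hc2 ⟨i, hi, h5⟩
          omega)
        push_cast at hS
        have hS' : (E * (E + 1) / 2 : ℝ) ≤ ∑ i ∈ S.erase c, (QTri (d i) : ℝ) := by nlinarith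
        have h6 : (0:ℝ) ≤ h * (2 * E - h + 1) := by nlinarith
        have h7 := mul_le_mul_of_nonneg_left hS' h6
        have h8 := h7.trans this
        refine le_of_mul_le_mul_left ?_ hEp
        calc _ = (h * (2 * E - h + 1) : ℝ) * (E * (E + 1) / 2) := by ring
          _ ≤ _ := h8
    push_cast
    nlinarith
  · have := ratio_sum S d h E hE (fun i hi => by
      have h3 := hd i hi
      have h4 : d i ≠ E + 1 := fun h5 => hc ⟨i, hi, h5⟩
      omega)
    push_cast at hS ⊢
    have h6 : (0:ℝ) ≤ h * (2 * E - h + 1) := by nlinarith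
    have h8 := (mul_le_mul_of_nonneg_left hS h6).trans this
    refine le_of_mul_le_mul_left (le_trans ?_ h8) hEp
    have : (0:ℝ) ≤ h * (E + 1) * (E + 1 - h) := by
      have : (0:ℝ) ≤ E + 1 - h := by linarith
      positivity
    nlinarith

lemma num_poly (h D x N : ℕ) (hD : h < D) (hx : D ≤ x) (hN : x + D ≤ N) (hN2 : 2 * D < N) :
    (2 * (D * (D + 1)) * (2 * N - 2 * h + 1) : ℝ) ≤ D * (D + 1) * (2 * x - h + 1)
      + (2 * D - h + 1) * (N * (N + 1) - x * (x + 1)) := by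
  obtain ⟨e, rfl⟩ := Nat.exists_eq_add_of_lt hD
  obtain ⟨s, rfl⟩ := Nat.exists_eq_add_of_le hx
  obtain ⟨t, rfl⟩ := Nat.exists_eq_add_of_le hN
  rw [← sub_nonneg]
  rcases Nat.eq_zero_or_pos s with rfl | hs
  · obtain ⟨u, rfl⟩ : ∃ u, t = u + 1 := ⟨t - 1, by omega⟩
    push_cast
    ring_nf
    positivity
  · obtain ⟨u, rfl⟩ : ∃ u, s = u + 1 := ⟨s - 1, by omega⟩
    push_cast
    ring_nf
    positivity

lemma num_main {ι : Type*} [DecidableEq ι] (S : Finset ι) (d : ι → ℕ) (N h r : ℕ) (a b : ι)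
    (ha : a ∈ S) (hb : b ∈ S) (hab : a ≠ b) (hdb : ∀ i ∈ S, i ≠ a → d i ≤ d b)
    (hba : d b ≤ d a) (hN : d a + d b ≤ N) (hr : 1 ≤ r) (hrN : r ≤ N) (hh : h = (r + 1) / 2)
    (hda : d a + h ≤ N) (hT : QTri N ≤ ∑ i ∈ S, QTri (d i)) :
    QTri N ≤ ∑ i ∈ S, (QTri (d i) - QTri (d i - h)) + QTri (N - r) := by
  have h1 : 1 ≤ h := by omega
  have hTR : (QTri N : ℝ) ≤ ∑ i ∈ S, (QTri (d i) : ℝ) := by exact_mod_cast hT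
  have hcast : ∀ i, ((QTri (d i) - QTri (d i - h) : ℕ) : ℝ) = QG h (d i) := fun i => by
    rw [Nat.cast_sub (QTri_mono (Nat.sub_le _ _))]; rfl
  suffices H : (QTri N : ℝ) ≤ ∑ i ∈ S, QG h (d i) + QTri (N - r) by
    have : ((QTri N : ℕ) : ℝ) ≤ ((∑ i ∈ S, (QTri (d i) - QTri (d i - h)) + QTri (N - r) : ℕ) : ℝ) := by
      rw [Nat.cast_add, Nat.cast_sum, Finset.sum_congr rfl fun i _ => hcast i]
      exact H
    exact_mod_cast this
  rcases le_or_gt (d b) h with hle | hlt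
  · have e1 : ∑ i ∈ S.erase a, QG h (d i) = ∑ i ∈ S.erase a, (QTri (d i) : ℝ) := by
      refine Finset.sum_congr rfl fun i hi => ?_
      have := hdb i (Finset.mem_of_mem_erase hi) (Finset.ne_of_mem_erase hi)
      rw [QG, Nat.sub_eq_zero_of_le (by omega)]
      simp [QTri]
    rw [← Finset.add_sum_erase S _ ha] at hTR ⊢
    rw [e1]
    have : (QTri (d a - h) : ℝ) ≤ QTri (N - r) := by exact_mod_cast QTri_mono (by omega)
    unfold QG
    linarith
  · have hmono : (QTri (N - 2 * h) : ℝ) ≤ QTri (N - r) := by exact_mod_cast QTri_mono (by omega)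
    have hTN : (QTri N : ℝ) - QTri (N - 2 * h) = h * (2 * N - 2 * h + 1) := by
      have := QG_eq (2 * h) N (by omega)
      unfold QG at this
      rw [this]; push_cast; ring
    suffices H : (h * (2 * N - 2 * h + 1) : ℝ) ≤ ∑ i ∈ S, QG h (d i) by linarith
    rw [← Finset.add_sum_erase S _ ha] at hTR ⊢
    have h1' : (1 : ℝ) ≤ h := by exact_mod_cast h1
    rcases Nat.lt_or_ge (2 * d b) N with h2 | h2
    · have hr := ratio_sum (S.erase a) d h (d b) hlt.le (fun i hi =>
        hdb i (Finset.mem_of_mem_erase hi) (Finset.ne_of_mem_erase hi))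
      have hp := num_poly h (d b) (d a) N hlt hba hN h2
      rw [QG_eq h (d a) (by omega)]
      have hlt' : (h : ℝ) + 1 ≤ d b := by exact_mod_cast hlt
      have h6 : (0:ℝ) ≤ h * (2 * d b - h + 1) := by nlinarith
      have h7 : (QTri N : ℝ) - QTri (d a) ≤ ∑ i ∈ S.erase a, (QTri (d i) : ℝ) := by linarith
      have h8 := (mul_le_mul_of_nonneg_left h7 h6).trans hr
      have hDp : (0:ℝ) < d b * (d b + 1) := by nlinarith
      refine le_of_mul_le_mul_left ?_ hDp
      refine le_trans ?_ (le_of_eq (mul_add _ _ _).symm)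
      refine le_trans ?_ (add_le_add_right h8 _)
      rw [QTri_cast, QTri_cast]
      have := mul_le_mul_of_nonneg_left hp (by positivity : (0:ℝ) ≤ h / 2)
      refine le_trans (le_of_eq ?_) (this.trans (le_of_eq ?_)) <;> ring
    · have hda2 : d a = d b := by omega
      have hN2 : N = 2 * d b := by omega
      have hb' : b ∈ S.erase a := Finset.mem_erase.2 ⟨hab.symm, hb⟩
      rw [← Finset.add_sum_erase _ _ hb', hda2] at hTR ⊢
      have := num_even ((S.erase a).erase b) d h (d b) h1 hlt (fun i hi =>
        hdb i (Finset.mem_of_mem_erase (Finset.mem_of_mem_erase hi))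
          (Finset.ne_of_mem_erase (Finset.mem_of_mem_erase hi))) (by
          rw [QTri_cast, QTri_cast, hN2] at hTR
          push_cast at hTR
          nlinarith)
      rw [QG_eq h (d b) hlt.le, hN2]
      push_cast
      linarith
section Iso
open Classical in
lemma zeros_count {F V : Type*} [Field F] [Fintype F] [AddCommGroup V] [Module F V] [Fintype V]
    (B : LinearMap.BilinForm F V) (hB : B.IsSymm) (U : Submodule F V) (v : V) (hv : v ∈ U)
    (hvv : B v v ≠ 0) :
    (Finset.univ.filter fun x : V => x ∈ U ∧ B x x = 0).card * Fintype.card F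
      ≤ 2 * (Finset.univ.filter fun x : V => x ∈ U).card := by
  rw [← Finset.card_univ (α := F), ← Finset.card_product]
  refine Finset.card_le_mul_card_image_of_maps_to (f := fun p : V × F => p.1 - p.2 • v) ?_ 2 ?_
  · rintro ⟨x, t⟩ hp
    simp only [Finset.mem_product, Finset.mem_filter, Finset.mem_univ, true_and, and_true] at hp ⊢
    exact U.sub_mem hp.1 (U.smul_mem _ hv)
  · intro x _
    let P : Polynomial F := Polynomial.C (B v v) * Polynomial.X ^ 2
      + Polynomial.C (2 * B x v) * Polynomial.X + Polynomial.C (B x x)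
    have hdeg : P.natDegree = 2 := Polynomial.natDegree_quadratic hvv
    have hP : P ≠ 0 := by
      intro h; rw [h] at hdeg; simp at hdeg
    refine le_trans ?_ ((Multiset.toFinset_card_le P.roots).trans (P.card_roots'.trans hdeg.le))
    refine Finset.card_le_card_of_injOn (fun p => p.2) ?_ ?_
    · rintro ⟨z, t⟩ hp
      simp only [Finset.coe_filter, Finset.mem_product, Finset.mem_filter, Finset.mem_univ,
        true_and, and_true, Set.mem_ofPred_eq] at hp
      obtain ⟨⟨_, hz⟩, rfl⟩ := hp
      simp only [Finset.mem_coe, Multiset.mem_toFinset]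
      rw [Polynomial.mem_roots hP]
      have hs : B v z = B z v := hB.eq v z
      simp only [P, Polynomial.IsRoot.def, Polynomial.eval_add, Polynomial.eval_mul,
        Polynomial.eval_C, Polynomial.eval_pow, Polynomial.eval_X]
      simp only [map_sub, map_smul,
        LinearMap.sub_apply, LinearMap.smul_apply, smul_eq_mul, hz, hs]
      ring
    · rintro ⟨z, t⟩ hp ⟨z', t'⟩ hp' h
      simp only [Finset.coe_filter, Set.mem_ofPred_eq] at hp hp' h
      have h1 := hp.2
      have h2 := hp'.2
      subst h
      rw [← h2] at h1
      have : z = z' := by simpa using h1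
      rw [this]

open Classical in
/-- number of isotropic tuples orthogonal to `W` -/
noncomputable def isoCount {F V : Type*} [Field F] [AddCommGroup V] [Module F V] [Fintype V]
    (B : LinearMap.BilinForm F V) (k : ℕ) (W : Submodule F V) : ℕ :=
  (Finset.univ.filter fun t : Fin k → V =>
    (∀ a, t a ∈ B.orthogonal W) ∧ ∀ a b, B (t a) (t b) = 0).card

open Classical in
lemma isoCount_succ {F V : Type*} [Field F] [AddCommGroup V] [Module F V] [Fintype V]
    (B : LinearMap.BilinForm F V) (k : ℕ) (W : Submodule F V) :
    isoCount B (k + 1) W ≤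
      ∑ x ∈ Finset.univ.filter (fun x : V => x ∈ B.orthogonal W ∧ B x x = 0),
        isoCount B k (W ⊔ Submodule.span F {x}) := by
  unfold isoCount
  rw [← Finset.card_sigma]
  refine Finset.card_le_card_of_injOn (fun t => ⟨t 0, fun i => t i.succ⟩) ?_ ?_
  · intro t ht
    simp only [Finset.coe_filter, Finset.mem_univ, true_and, Set.mem_ofPred_eq] at ht
    simp only [Finset.coe_sigma, Finset.coe_filter, Finset.mem_univ, true_and, Set.mem_sigma_iff,
      Set.mem_ofPred_eq]
    refine ⟨⟨ht.1 0, ht.2 0 0⟩, fun a => ?_, fun a b => ht.2 _ _⟩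
    rw [LinearMap.BilinForm.mem_orthogonal_iff]
    intro y hy
    rw [Submodule.mem_sup] at hy
    obtain ⟨w, hw, z, hz, rfl⟩ := hy
    rw [Submodule.mem_span_singleton] at hz
    obtain ⟨c, rfl⟩ := hz
    have h1 := (LinearMap.BilinForm.mem_orthogonal_iff).1 (ht.1 a.succ) w hw
    have h2 := ht.2 0 a.succ
    simp [h1, h2]
  · intro t _ t' _ h
    simp only [Sigma.mk.injEq] at h
    funext i
    refine Fin.cases h.1 (fun j => ?_) i
    exact congrFun (eq_of_heq h.2) j

lemma card_sub {F V : Type*} [Field F] [Fintype F] [AddCommGroup V] [Module F V] [Fintype V]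
    (U : Submodule F V) [DecidablePred fun x => x ∈ U] :
    (Finset.univ.filter fun x : V => x ∈ U).card = Fintype.card F ^ Module.finrank F U := by
  classical
  rw [← Module.card_eq_pow_finrank (K := F) (V := U)]
  exact (Fintype.card_subtype _).symm

lemma iso_main {F V : Type*} [Field F] [Fintype F] (h2 : (2 : F) ≠ 0)
    [AddCommGroup V] [Module F V] [Fintype V]
    (B : LinearMap.BilinForm F V) (hB : B.IsSymm) (g ρ h : ℕ)
    (hg : Module.finrank F (B.orthogonal ⊤) = g) (hN : Module.finrank F V = g + ρ)
    (hh : h = (ρ + 1) / 2) (k : ℕ) :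
    ∀ (W : Submodule F V) (m : ℕ), B.orthogonal ⊤ ≤ W → W ≤ B.orthogonal W →
      Module.finrank F W = g + m →
      isoCount B k W * Fintype.card F ^ (k * m + QTri k - QTri (k + m - h)) ≤
        3 ^ k * Fintype.card F ^ (k * (g + ρ)) := by
  classical
  set q := Fintype.card F with hq
  have hq1 : 1 ≤ q := Fintype.card_pos
  have hrefl : B.IsRefl := hB.isRefl
  have hfin : FiniteDimensional F V := Module.Finite.of_finite
  induction k with
  | zero =>
    intro W m _ hW hm
    have hd := LinearMap.BilinForm.finrank_add_finrank_orthogonal hrefl W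
    have : QTri (0 + m - h) = 0 := by
      have : Module.finrank F W ≤ Module.finrank F (B.orthogonal W) := Submodule.finrank_mono hW
      have h3 : Module.finrank F ↥(W ⊓ B.orthogonal ⊤) ≤ g := hg ▸ Submodule.finrank_mono inf_le_right
      have : 0 + m - h = 0 := by omega
      rw [this]; rfl
    have h0 : QTri 0 = 0 := rfl
    simp only [isoCount, zero_mul, h0]
    simp
  | succ k ih =>
    intro W m hΓ hW hm
    have hd := LinearMap.BilinForm.finrank_add_finrank_orthogonal hrefl W
    rw [inf_eq_right.2 hΓ, hm, hg, hN] at hd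
    have hle : Module.finrank F W ≤ Module.finrank F (B.orthogonal W) := Submodule.finrank_mono hW
    have hΓ' : B.orthogonal ⊤ ≤ B.orthogonal W := LinearMap.BilinForm.orthogonal_le le_top
    have hd2 := LinearMap.BilinForm.finrank_add_finrank_orthogonal hrefl (B.orthogonal W)
    rw [inf_eq_right.2 hΓ', hg, hN] at hd2
    have hWW : B.orthogonal (B.orthogonal W) = W :=
      (Submodule.eq_of_le_of_finrank_eq (LinearMap.BilinForm.le_orthogonal_orthogonal hrefl)
        (by omega)).symm
    have hmono : QTri (k + 1 + m - h) ≤ QTri (k + 1) := QTri_mono (by omega)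
    have hmono2 : QTri (k + m - h) ≤ QTri k := QTri_mono (by omega)
    have hE1 : (k + 1) * m + QTri (k + 1) - QTri (k + 1 + m - h) ≤
        (k * m + QTri k - QTri (k + m - h)) + h := by
      have e1 : (k + 1) * m = k * m + m := by ring
      have e2 := QTri_succ k
      rcases Nat.lt_or_ge (k + m) h with h5 | h5
      · have e5 : k + 1 + m - h = 0 := by omega
        have e6 : k + m - h = 0 := by omega
        have e7 : QTri 0 = 0 := rfl
        rw [e5, e6, e7]
        omega
      · have e3 : k + 1 + m - h = (k + m - h) + 1 := by omega
        have e4 := QTri_succ (k + m - h)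
        rw [e3] at hmono ⊢
        omega
    have hE2 : m + 1 ≤ h → (k + 1) * m + QTri (k + 1) - QTri (k + 1 + m - h) =
        (k * (m + 1) + QTri k - QTri (k + (m + 1) - h)) + (m + 1) := by
      intro hmh
      have hmono3 : QTri (k + (m + 1) - h) ≤ QTri k := QTri_mono (by omega)
      have e1 : (k + 1) * m = k * m + m := by ring
      have e3 : k * (m + 1) = k * m + k := by ring
      have e2 := QTri_succ k
      have e4 : k + 1 + m - h = k + (m + 1) - h := by omega
      rw [e4] at hmono ⊢
      omega
    set E := (k + 1) * m + QTri (k + 1) - QTri (k + 1 + m - h) with hE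
    set Z := Finset.univ.filter (fun x : V => x ∈ B.orthogonal W ∧ B x x = 0) with hZ
    have hsplit := isoCount_succ B k W
    rw [← Finset.sum_filter_add_sum_filter_not _ (fun x => x ∈ W)] at hsplit
    set M := 3 ^ k * q ^ (k * (g + ρ)) with hM
    have hstay : (∑ x ∈ Z.filter (fun x => x ∈ W), isoCount B k (W ⊔ Submodule.span F {x})) * q ^ E
        ≤ M * q ^ (g + ρ) := by
      have e1 : ∑ x ∈ Z.filter (fun x => x ∈ W), isoCount B k (W ⊔ Submodule.span F {x})
          = (Z.filter (fun x => x ∈ W)).card * isoCount B k W := by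
        rw [Finset.sum_congr rfl (g := fun _ => isoCount B k W), Finset.sum_const, smul_eq_mul]
        intro x hx
        have hx := (Finset.mem_filter.1 hx).2
        rw [sup_eq_left.2]
        rwa [Submodule.span_singleton_le_iff_mem]
      have e2 : (Z.filter (fun x => x ∈ W)).card ≤ q ^ (g + m) := by
        rw [← hm, ← card_sub]
        exact Finset.card_le_card (Finset.filter_subset_filter _ (Finset.subset_univ _))
      rw [e1]
      have e3 := ih W m hΓ hW hm
      calc _ ≤ q ^ (g + m) * isoCount B k W * q ^ ((k * m + QTri k - QTri (k + m - h)) + h) := by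
            gcongr
        _ = (isoCount B k W * q ^ (k * m + QTri k - QTri (k + m - h))) * q ^ (g + m + h) := by
            rw [pow_add, pow_add q (g + m) h]; ring
        _ ≤ M * q ^ (g + ρ) := by
            exact Nat.mul_le_mul e3 (Nat.pow_le_pow_right hq1 (by omega))
    have hup : (∑ x ∈ Z.filter (fun x => ¬ x ∈ W), isoCount B k (W ⊔ Submodule.span F {x})) * q ^ E
        ≤ 2 * (M * q ^ (g + ρ)) := by
      have e1 : (Z.filter (fun x => ¬ x ∈ W)).card * q ≤ 2 * q ^ (Module.finrank F (B.orthogonal W)) := by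
        by_cases hne : (Z.filter (fun x => ¬ x ∈ W)).Nonempty
        · obtain ⟨x, hx⟩ := hne
          simp only [hZ, Finset.mem_filter, Finset.mem_univ, true_and] at hx
          obtain ⟨⟨hx1, hxx⟩, hxW⟩ := hx
          rw [← hWW, LinearMap.BilinForm.mem_orthogonal_iff] at hxW
          push Not at hxW
          obtain ⟨y, hy, hyx⟩ := hxW
          have hv : ∃ v ∈ B.orthogonal W, B v v ≠ 0 := by
            by_cases hyy : B y y = 0
            · refine ⟨x + y, Submodule.add_mem _ hx1 hy, ?_⟩
              have hs : B x y = B y x := hB.eq x y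
              simp only [map_add, LinearMap.add_apply, hxx, hyy, hs, zero_add, add_zero]
              rw [← two_mul]
              exact mul_ne_zero h2 hyx
            · exact ⟨y, hy, hyy⟩
          obtain ⟨v, hv, hvv⟩ := hv
          have := zeros_count B hB _ v hv hvv
          rw [card_sub] at this
          refine le_trans ?_ this
          gcongr
          exact Finset.filter_subset _ _
        · rw [Finset.not_nonempty_iff_eq_empty] at hne
          rw [hne]; simp
      have e2 : ∀ x ∈ Z.filter (fun x => ¬ x ∈ W),
          isoCount B k (W ⊔ Submodule.span F {x}) * q ^ (k * (m + 1) + QTri k - QTri (k + (m + 1) - h))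
            ≤ M := by
        intro x hx
        simp only [hZ, Finset.mem_filter, Finset.mem_univ, true_and] at hx
        obtain ⟨⟨hx1, hxx⟩, hxW⟩ := hx
        refine ih _ _ (hΓ.trans le_sup_left) ?_ ?_
        · intro y hy
          rw [Submodule.mem_sup] at hy
          obtain ⟨w, hw, z, hz, rfl⟩ := hy
          rw [Submodule.mem_span_singleton] at hz
          obtain ⟨c, rfl⟩ := hz
          rw [LinearMap.BilinForm.mem_orthogonal_iff]
          intro y' hy'
          rw [Submodule.mem_sup] at hy'
          obtain ⟨w', hw', z, hz, rfl⟩ := hy'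
          rw [Submodule.mem_span_singleton] at hz
          obtain ⟨c', rfl⟩ := hz
          have a1 : B w' w = 0 := (LinearMap.BilinForm.mem_orthogonal_iff).1 (hW hw) w' hw'
          have a2 : B w' x = 0 := (LinearMap.BilinForm.mem_orthogonal_iff).1 hx1 w' hw'
          have a3 : B x w = 0 := by
            refine (hB.eq x w).trans ?_
            exact (LinearMap.BilinForm.mem_orthogonal_iff).1 hx1 w hw
          simp [a1, a2, a3, hxx]
        · have hxne : x ≠ 0 := fun h0 => hxW (h0 ▸ W.zero_mem)
          have b1 := Submodule.finrank_sup_add_finrank_inf_eq W (Submodule.span F {x})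
          have b2 : W ⊓ Submodule.span F {x} = ⊥ := by
            rw [← disjoint_iff]
            exact (Submodule.disjoint_span_singleton' hxne).2 hxW
          rw [b2, finrank_bot, finrank_span_singleton hxne, hm] at b1
          omega
      rcases Nat.lt_or_ge m h with hmh | hmh
      swap
      · have hWW2 : W = B.orthogonal W := Submodule.eq_of_le_of_finrank_eq hW (by omega)
        rw [Finset.sum_eq_zero]
        · simp
        · intro x hx
          simp only [hZ, Finset.mem_filter, Finset.mem_univ, true_and] at hx
          exact absurd (hWW2 ▸ hx.1.1) hx.2
      rw [hE2 hmh, pow_add, ← mul_assoc, Finset.sum_mul]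
      calc _ ≤ ((Z.filter (fun x => ¬ x ∈ W)).card * M) * q ^ (m + 1) := by
            gcongr
            rw [← smul_eq_mul]
            exact Finset.sum_le_card_nsmul _ _ _ e2
        _ = ((Z.filter (fun x => ¬ x ∈ W)).card * q) * (M * q ^ m) := by rw [pow_succ]; ring
        _ ≤ (2 * q ^ (Module.finrank F (B.orthogonal W))) * (M * q ^ m) := by gcongr
        _ = 2 * (M * q ^ (Module.finrank F (B.orthogonal W) + m)) := by rw [pow_add]; ring
        _ = _ := by congr 3; omega
    calc _ ≤ (_ + _) * q ^ E := Nat.mul_le_mul_right _ hsplit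
      _ ≤ M * q ^ (g + ρ) + 2 * (M * q ^ (g + ρ)) := by rw [add_mul]; exact add_le_add hstay hup
      _ = _ := by rw [hM, add_mul k 1, one_mul, pow_add q, pow_succ]; ring
end Iso
section Form

/-- the rows of the symmetric matrix of coefficients -/
def symRow {F : Type*} {N : ℕ} (c : Sym2 (Fin N) → F) : Fin N → Fin N → F :=
  fun i j => c s(i, j)

/-- the symmetric bilinear form of coefficients -/
noncomputable def symForm {F : Type*} [Field F] {N : ℕ} (c : Sym2 (Fin N) → F) :
    LinearMap.BilinForm F (Fin N → F) := Matrix.toBilin' (Matrix.of (symRow c))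

lemma symForm_apply {F : Type*} [Field F] {N : ℕ} (c : Sym2 (Fin N) → F) (x y : Fin N → F) :
    symForm c x y = ∑ i, ∑ j, x i * c s(i, j) * y j := by
  rw [symForm, Matrix.toBilin'_apply]; rfl

lemma symForm_symm {F : Type*} [Field F] {N : ℕ} (c : Sym2 (Fin N) → F) :
    (symForm c).IsSymm := by
  refine ⟨fun x y => ?_⟩
  rw [symForm_apply, symForm_apply, Finset.sum_comm]
  refine Finset.sum_congr rfl fun i _ => Finset.sum_congr rfl fun j _ => ?_
  rw [Sym2.eq_swap]; ring

lemma exists_rows {F : Type*} [Field F] {N : ℕ} (c : Sym2 (Fin N) → F) :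
    ∃ I : Finset (Fin N), I.card + Module.finrank F ((symForm c).orthogonal ⊤) = N ∧
      ∀ j, symRow c j ∈ Submodule.span F (symRow c '' (I : Set (Fin N))) := by
  classical
  obtain ⟨b, -, -, hb, hli⟩ := exists_linearIndepOn_extension (K := F) (v := symRow c)
    (linearIndepOn_empty F (symRow c)) (Set.empty_subset Set.univ)
  have hspan : ∀ j, symRow c j ∈ Submodule.span F (symRow c '' b) := fun j =>
    hb ⟨j, Set.mem_univ _, rfl⟩
  refine ⟨b.toFinset, ?_, by simpa using hspan⟩
  have h1 : Module.finrank F (Submodule.span F (Set.range (symRow c))) = b.toFinset.card := by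
    have h2 : Submodule.span F (Set.range (symRow c)) = Submodule.span F (symRow c '' b) := by
      refine le_antisymm (Submodule.span_le.2 ?_) (Submodule.span_mono (Set.image_subset_range _ _))
      rintro _ ⟨j, rfl⟩
      exact hspan j
    rw [h2]
    have := finrank_span_eq_card (R := F) hli
    rw [Set.toFinset_card, ← this, Set.image_eq_range]
  have h3 : (symForm c).orthogonal ⊤ = LinearMap.ker (Matrix.of (symRow c)).mulVecLin := by
    ext y
    rw [LinearMap.BilinForm.mem_orthogonal_iff, LinearMap.mem_ker, Matrix.mulVecLin_apply]
    simp only [Submodule.mem_top, true_imp_iff, symForm, Matrix.toBilin'_apply']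
    constructor
    · intro h
      exact dotProduct_eq_zero _ fun x => (dotProduct_comm _ _).trans (h x)
    · intro h x; rw [h]; simp
  have h4 := LinearMap.finrank_range_add_finrank_ker (Matrix.of (symRow c)).mulVecLin
  have h5 : (Matrix.of (symRow c)).col = symRow c := by
    funext i j
    simp [symRow, Matrix.col, Sym2.eq_swap]
  rw [Matrix.range_mulVecLin, h5, h1, ← h3] at h4
  simpa using h4

lemma rows_unique {F : Type*} [Field F] {N : ℕ} (c c' : Sym2 (Fin N) → F) (I : Finset (Fin N))
    (hc : ∀ j, symRow c j ∈ Submodule.span F (symRow c '' (I : Set (Fin N))))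
    (hc' : ∀ j, symRow c' j ∈ Submodule.span F (symRow c' '' (I : Set (Fin N))))
    (h : ∀ s : Sym2 (Fin N), (∃ i ∈ I, i ∈ s) → c s = c' s) : c = c' := by
  have hrow : ∀ i ∈ I, symRow c i = symRow c' i := by
    intro i hi
    funext k
    exact h _ ⟨i, hi, by simp⟩
  have himg : symRow c' '' (I : Set (Fin N)) = symRow c '' (I : Set (Fin N)) :=
    Set.image_congr fun i hi => (hrow i hi).symm
  rw [himg] at hc'
  have key : ∀ w ∈ Submodule.span F (symRow c '' (I : Set (Fin N))),
      (∀ i ∈ I, w i = 0) → w = 0 := by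
    intro w hw h0
    rw [Submodule.mem_span_image_finset_iff_exists_fun'] at hw
    obtain ⟨μ, rfl⟩ := hw
    have h1 : ∀ v ∈ Submodule.span F (symRow c '' (I : Set (Fin N))), ∑ i ∈ I, μ i * v i = 0 := by
      intro v hv
      induction hv using Submodule.span_induction with
      | mem x hx =>
        obtain ⟨k, hk, rfl⟩ := hx
        rw [← h0 k hk, Finset.sum_apply]
        refine Finset.sum_congr rfl fun i _ => ?_
        simp [symRow, Sym2.eq_swap]
      | zero => simp
      | add x y _ _ hx hy => simp [mul_add, Finset.sum_add_distrib, hx, hy]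
      | smul a x _ hx =>
        have : ∑ i ∈ I, μ i * (a • x) i = a * ∑ i ∈ I, μ i * x i := by
          rw [Finset.mul_sum]
          refine Finset.sum_congr rfl fun i _ => ?_
          simp; ring
        rw [this, hx, mul_zero]
    funext k
    rw [Finset.sum_apply, Pi.zero_apply, ← h1 _ (hc k)]
    refine Finset.sum_congr rfl fun i _ => ?_
    simp [symRow, Sym2.eq_swap]
  funext s
  induction s using Sym2.ind with
  | _ j k =>
    have := key (symRow c j - symRow c' j) (Submodule.sub_mem _ (hc j) (hc' j)) (by
      intro i hi
      rw [Pi.sub_apply, sub_eq_zero]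
      exact h _ ⟨i, hi, by simp⟩)
    exact sub_eq_zero.1 (congrFun this k)

open Classical in
lemma rows_count {F : Type*} [Field F] [Fintype F] {N : ℕ} (I : Finset (Fin N))
    (S : Finset (Sym2 (Fin N) → F))
    (hS : ∀ c ∈ S, ∀ j, symRow c j ∈ Submodule.span F (symRow c '' (I : Set (Fin N)))) :
    S.card ≤ Fintype.card F ^ (QTri N - QTri (N - I.card)) := by
  have e : Fintype.card {s : Sym2 (Fin N) // ∃ i ∈ I, i ∈ s} = QTri N - QTri (N - I.card) := by
    rw [Fintype.card_subtype]
    have h1 : (Finset.univ.filter fun s : Sym2 (Fin N) => ∃ i ∈ I, i ∈ s) = (Iᶜ.sym2)ᶜ := by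
      ext s
      simp only [Finset.mem_filter, Finset.mem_univ, true_and, Finset.mem_compl,
        Finset.mem_sym2_iff]
      push Not
      exact ⟨fun ⟨i, h1, h2⟩ => ⟨i, h2, h1⟩, fun ⟨i, h1, h2⟩ => ⟨i, h2, h1⟩⟩
    rw [h1, Finset.card_compl, Finset.card_sym2, Sym2.card, Finset.card_compl, Fintype.card_fin]
    rfl
  rw [← e, ← Fintype.card_fun, ← Finset.card_univ]
  refine Finset.card_le_card_of_injOn (fun c s => c s.1) (fun _ _ => Finset.mem_coe.2 (Finset.mem_univ _)) ?_
  intro c hc c' hc' h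
  exact rows_unique c c' I (hS c hc) (hS c' hc') fun s hs => congrFun h ⟨s, hs⟩

lemma iso_dim {F V : Type*} [Field F] [AddCommGroup V] [Module F V] [FiniteDimensional F V]
    (B : LinearMap.BilinForm F V) (hB : B.IsSymm) (d : ℕ) (t : Fin d → V)
    (hli : LinearIndependent F t) (ht : ∀ a b, B (t a) (t b) = 0) :
    2 * d ≤ Module.finrank F V + Module.finrank F (B.orthogonal ⊤) := by
  have h1 := LinearMap.BilinForm.finrank_add_finrank_orthogonal hB.isRefl
    (Submodule.span F (Set.range t))
  have h2 : Submodule.span F (Set.range t) ≤ B.orthogonal (Submodule.span F (Set.range t)) := by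
    rw [Submodule.span_le]
    rintro _ ⟨a, rfl⟩
    rw [SetLike.mem_coe, LinearMap.BilinForm.mem_orthogonal_iff]
    intro y hy
    induction hy using Submodule.span_induction with
    | mem x hx => obtain ⟨b, rfl⟩ := hx; exact ht b a
    | zero => simp
    | add x y _ _ hx hy => simp only [map_add, LinearMap.add_apply, hx, hy, add_zero]
    | smul c x _ hx => simp only [map_smul, LinearMap.smul_apply, hx, smul_zero]
  have h3 := Submodule.finrank_mono h2
  have h4 : Module.finrank F ↥(Submodule.span F (Set.range t) ⊓ B.orthogonal ⊤)
    ≤ Module.finrank F (B.orthogonal ⊤) := Submodule.finrank_mono inf_le_right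
  have h5 := finrank_span_eq_card hli
  rw [Fintype.card_fin] at h5
  omega

open Classical in
lemma iso_tuples {F V : Type*} [Field F] [Fintype F] (h2 : (2 : F) ≠ 0)
    [AddCommGroup V] [Module F V] [Fintype V]
    (B : LinearMap.BilinForm F V) (hB : B.IsSymm) (g ρ h : ℕ)
    (hg : Module.finrank F (B.orthogonal ⊤) = g) (hN : Module.finrank F V = g + ρ)
    (hh : h = (ρ + 1) / 2) (k : ℕ) :
    (Finset.univ.filter fun t : Fin k → V => ∀ a b, B (t a) (t b) = 0).card *
      Fintype.card F ^ (QTri k - QTri (k - h)) ≤ 3 ^ k * Fintype.card F ^ (k * (g + ρ)) := by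
  have hfin : FiniteDimensional F V := Module.Finite.of_finite
  have hall : ∀ x, x ∈ B.orthogonal (B.orthogonal ⊤) := fun x =>
    LinearMap.BilinForm.le_orthogonal_orthogonal hB.isRefl (Submodule.mem_top)
  have := iso_main h2 B hB g ρ h hg hN hh k (B.orthogonal ⊤) 0 le_rfl (fun x _ => hall x) (by simpa)
  simpa [isoCount, hall] using this

end Form
section Union

open Classical in
lemma li_count {F V : Type*} [Field F] [Fintype F] [AddCommGroup V] [Module F V] [Fintype V]
    (k : ℕ) (hk : k ≤ Module.finrank F V) :
    Fintype.card (Fin k → V) ≤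
      2 ^ k * (Finset.univ.filter fun t : Fin k → V => LinearIndependent F t).card := by
  have h1 := card_linearIndependent (K := F) (V := V) hk
  rw [Nat.card_eq_fintype_card, Fintype.card_subtype] at h1
  rw [h1, Fintype.card_fun, Fintype.card_fin, Module.card_eq_pow_finrank (K := F) (V := V)]
  have e1 : (2 : ℕ) ^ k = ∏ _i : Fin k, 2 := by simp
  have e2 : (Fintype.card F ^ Module.finrank F V) ^ k =
    ∏ _i : Fin k, Fintype.card F ^ Module.finrank F V := by simp
  rw [e1, e2, ← Finset.prod_mul_distrib]
  refine Finset.prod_le_prod' fun i _ => ?_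
  have hq : 2 ≤ Fintype.card F := Fintype.one_lt_card
  have h3 : Fintype.card F ^ (i.val + 1) ≤ Fintype.card F ^ Module.finrank F V :=
    Nat.pow_le_pow_right (by omega) (by omega)
  rw [pow_succ] at h3
  have h4 : Fintype.card F ^ i.val * 2 ≤ Fintype.card F ^ i.val * Fintype.card F :=
    Nat.mul_le_mul_left _ hq
  omega

open Classical in
lemma exists_good_field {F ι : Type*} [Field F] [Fintype F] (h2 : (2 : F) ≠ 0) [Fintype ι]
    (d : ι → ℕ) (N : ℕ) (a b : ι) (hab : a ≠ b) (hdb : ∀ i, i ≠ a → d i ≤ d b)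
    (hba : d b ≤ d a) (hN : d a + d b ≤ N) (hT : QTri N ≤ ∑ i, QTri (d i))
    (hq : 2 ^ N * 3 ^ (∑ i, d i) * 2 ^ (∑ i, d i) + 1 < Fintype.card F) :
    ∃ X : ∀ i, Fin (d i) → Fin N → F, ∀ c : Sym2 (Fin N) → F,
      (∀ i k l, symForm c (X i k) (X i l) = 0) → c = 0 := by
  by_contra hcon
  push Not at hcon
  set q := Fintype.card F with hqdef
  set D := ∑ i, d i with hD
  have hq1 : 1 ≤ q := Fintype.card_pos
  choose I hI1 hI2 using fun c : Sym2 (Fin N) → F => exists_rows c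
  let P : ∀ i, Finset (Fin (d i) → Fin N → F) := fun i =>
    Finset.univ.filter fun t => i = a → LinearIndependent F t
  let G : Finset (∀ i, Fin (d i) → Fin N → F) := Fintype.piFinset P
  let R : (∀ i, Fin (d i) → Fin N → F) → (Sym2 (Fin N) → F) → Prop := fun X c =>
    c ≠ 0 ∧ ∀ i k l, symForm c (X i k) (X i l) = 0
  have hcardV : Fintype.card (Fin N → F) = q ^ N := by simp [hqdef]
  have hAll : Fintype.card (∀ i, Fin (d i) → Fin N → F) = q ^ (D * N) := by
    rw [Fintype.card_pi]
    simp only [Fintype.card_fun, Fintype.card_fin]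
    rw [hD, Finset.sum_mul, ← Finset.prod_pow_eq_pow_sum]
    refine Finset.prod_congr rfl fun i _ => ?_
    rw [← pow_mul, mul_comm]
  have hG : q ^ (D * N) ≤ 2 ^ D * G.card := by
    rw [← hAll, Fintype.card_pi, Fintype.card_piFinset, hD, ← Finset.prod_pow_eq_pow_sum,
      ← Finset.prod_mul_distrib]
    refine Finset.prod_le_prod' fun i _ => ?_
    by_cases hi : i = a
    · have := li_count (F := F) (V := Fin N → F) (d i) (by rw [hi]; simp; omega)
      simpa [P, hi] using this
    · simp only [P, hi, false_imp_iff, Finset.filter_true, Finset.card_univ]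
      exact Nat.le_mul_of_pos_left _ (by positivity)
  have hGpos : 0 < G.card := by
    by_contra h
    have h0 : G.card = 0 := by omega
    rw [h0, mul_zero] at hG
    have : 0 < q ^ (D * N) := by positivity
    omega
  -- lower bound
  have hlow : G.card * (q - 1) ≤ ∑ X ∈ G, (Finset.univ.filter fun c => R X c).card := by
    rw [← smul_eq_mul]
    refine Finset.card_nsmul_le_sum _ _ _ fun X _ => ?_
    obtain ⟨c, hc, hc0⟩ := hcon X
    have : q - 1 = (Finset.univ.filter fun t : F => t ≠ 0).card := by
      rw [Finset.filter_ne', Finset.card_erase_of_mem (Finset.mem_univ _), Finset.card_univ]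
    rw [this]
    refine Finset.card_le_card_of_injOn (fun t => t • c) ?_ ?_
    · intro t ht
      simp only [Finset.coe_filter, Finset.mem_univ, true_and, Set.mem_ofPred_eq] at ht ⊢
      refine ⟨smul_ne_zero ht hc0, fun i k l => ?_⟩
      have h := hc i k l
      rw [symForm_apply] at h ⊢
      rw [← mul_zero t, ← h, Finset.mul_sum]
      refine Finset.sum_congr rfl fun _ _ => ?_
      rw [Finset.mul_sum]
      refine Finset.sum_congr rfl fun _ _ => ?_
      simp only [Pi.smul_apply, smul_eq_mul]; ring
    · intro t _ t' _ h
      exact smul_left_injective F hc0 h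
  -- upper bound for a single form
  have hK : ∀ c : Sym2 (Fin N) → F,
      (G.filter fun X => R X c).card * q ^ (QTri N - QTri (N - (I c).card)) ≤
        3 ^ D * q ^ (D * N) := by
    intro c
    by_cases hne : (G.filter fun X => R X c).Nonempty
    swap
    · rw [Finset.not_nonempty_iff_eq_empty] at hne
      rw [hne]; simp
    obtain ⟨X, hX⟩ := hne
    obtain ⟨hXG, hc0, hX⟩ := Finset.mem_filter.1 hX
    have hXa : LinearIndependent F (X a) := by
      have := (Fintype.mem_piFinset.1 hXG) a
      exact (Finset.mem_filter.1 this).2 rfl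
    have hsym := symForm_symm c
    have hdim := iso_dim (symForm c) hsym (d a) (X a) hXa (hX a)
    have hfr : Module.finrank F (Fin N → F) = N := by simp
    rw [hfr] at hdim
    have hIc := hI1 c
    set g := Module.finrank F ((symForm c).orthogonal ⊤) with hg
    set ρ := (I c).card with hρ
    have hρ1 : 1 ≤ ρ := by
      by_contra h0
      have h0 : (I c).card = 0 := by omega
      rw [Finset.card_eq_zero] at h0
      apply hc0
      funext s
      induction s using Sym2.ind with
      | _ j k =>
        have := hI2 c j
        rw [h0] at this
        simp only [Finset.coe_empty, Set.image_empty, Submodule.span_empty, Submodule.mem_bot]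
          at this
        exact congrFun this k
    obtain ⟨h, hh⟩ : ∃ h, h = (ρ + 1) / 2 := ⟨_, rfl⟩
    have hnum := num_main Finset.univ d N h ρ a b (Finset.mem_univ _) (Finset.mem_univ _) hab
      (fun i _ => hdb i) hba hN hρ1 (by omega) hh (by omega) hT
    have hcard : (G.filter fun X => R X c).card ≤
        ∏ i, (Finset.univ.filter fun t : Fin (d i) → Fin N → F =>
          ∀ k l, symForm c (t k) (t l) = 0).card := by
      rw [← Fintype.card_piFinset]
      refine Finset.card_le_card fun X hX => ?_
      have := (Finset.mem_filter.1 hX).2.2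
      simpa [Fintype.mem_piFinset] using this
    calc _ ≤ (∏ i, (Finset.univ.filter fun t : Fin (d i) → Fin N → F =>
          ∀ k l, symForm c (t k) (t l) = 0).card) * q ^ (∑ i, (QTri (d i) - QTri (d i - h))) :=
          Nat.mul_le_mul hcard (Nat.pow_le_pow_right hq1 (by omega))
      _ = ∏ i, ((Finset.univ.filter fun t : Fin (d i) → Fin N → F =>
          ∀ k l, symForm c (t k) (t l) = 0).card * q ^ (QTri (d i) - QTri (d i - h))) := by
          rw [Finset.prod_mul_distrib, Finset.prod_pow_eq_pow_sum]
      _ ≤ ∏ i, (3 ^ d i * q ^ (d i * (g + ρ))) :=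
          Finset.prod_le_prod' fun i _ => iso_tuples h2 (symForm c) hsym g ρ h rfl
            (by rw [hfr]; omega) hh (d i)
      _ = _ := by
          rw [Finset.prod_mul_distrib, Finset.prod_pow_eq_pow_sum, Finset.prod_pow_eq_pow_sum,
            ← Finset.sum_mul, ← hD]
          congr 3; omega
  have hswap : ∑ X ∈ G, (Finset.univ.filter fun c => R X c).card =
      ∑ c, (G.filter fun X => R X c).card := by
    simp only [Finset.card_filter]
    exact Finset.sum_comm
  have hup : ∑ c, (G.filter fun X => R X c).card ≤ 2 ^ N * (3 ^ D * q ^ (D * N)) := by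
    rw [← Finset.sum_fiberwise Finset.univ I]
    have e1 : (2 : ℕ) ^ N = (Finset.univ : Finset (Finset (Fin N))).card := by simp
    rw [e1, ← smul_eq_mul]
    refine Finset.sum_le_card_nsmul _ _ _ fun J _ => ?_
    have hpos : 0 < q ^ (QTri N - QTri (N - J.card)) := by positivity
    refine Nat.le_of_mul_le_mul_right ?_ hpos
    rw [Finset.sum_mul]
    refine (Finset.sum_le_card_nsmul _ _ (3 ^ D * q ^ (D * N)) ?_).trans ?_
    · intro c hc
      have hc := (Finset.mem_filter.1 hc).2
      have := hK c
      rwa [hc] at this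
    · rw [smul_eq_mul, mul_comm]
      refine Nat.mul_le_mul_left _ (rows_count J _ ?_)
      intro c hc j
      have hc := (Finset.mem_filter.1 hc).2
      rw [← hc]
      exact hI2 c j
  have hfin : G.card * (q - 1) ≤ G.card * (2 ^ N * 3 ^ D * 2 ^ D) := by
    refine hlow.trans (hswap.le.trans (hup.trans ?_))
    calc _ ≤ 2 ^ N * (3 ^ D * (2 ^ D * G.card)) := by gcongr
      _ = _ := by ring
  have := Nat.le_of_mul_le_mul_left hfin hGpos
  omega

lemma exists_good {ι : Type*} [Fintype ι]
    (d : ι → ℕ) (N : ℕ) (a b : ι) (hab : a ≠ b) (hdb : ∀ i, i ≠ a → d i ≤ d b)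
    (hba : d b ≤ d a) (hN : d a + d b ≤ N) (hT : QTri N ≤ ∑ i, QTri (d i)) :
    ∃ p : ℕ, ∃ _ : Fact p.Prime,
    ∃ X : ∀ i, Fin (d i) → Fin N → ZMod p, ∀ c : Sym2 (Fin N) → ZMod p,
      (∀ i k l, symForm c (X i k) (X i l) = 0) → c = 0 := by
  obtain ⟨p, hp, hpp⟩ := Nat.exists_infinite_primes
    (2 ^ N * 3 ^ (∑ i, d i) * 2 ^ (∑ i, d i) + 3)
  have : Fact p.Prime := ⟨hpp⟩
  refine ⟨p, ⟨hpp⟩, exists_good_field ?_ d N a b hab hdb hba hN hT ?_⟩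
  · intro h
    have h' : ((2 : ℕ) : ZMod p) = 0 := by exact_mod_cast h
    rw [ZMod.natCast_eq_zero_iff] at h'
    have := Nat.le_of_dvd (by norm_num) h'
    omega
  · rw [ZMod.card]; omega

end Union
section Lift

/-- evaluation matrix: rows are pairs of vectors from the same family, columns are monomials -/
def evMat {R ι : Type*} [CommRing R] {d : ι → ℕ} {N : ℕ} (X : ∀ i, Fin (d i) → Fin N → R) :
    Matrix (Σ i, Fin (d i) × Fin (d i)) (Sym2 (Fin N)) R :=
  Matrix.of fun κ s => ∑ j, ∑ k, if s(j, k) = s then X κ.1 κ.2.1 j * X κ.1 κ.2.2 k else 0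

lemma evMat_sum {R M ι : Type*} [CommRing R] [AddCommGroup M] [Module R M] {d : ι → ℕ} {N : ℕ}
    (X : ∀ i, Fin (d i) → Fin N → R) (κ : Σ i, Fin (d i) × Fin (d i)) (c : Sym2 (Fin N) → M) :
    ∑ s, evMat X κ s • c s = ∑ j, ∑ k, (X κ.1 κ.2.1 j * X κ.1 κ.2.2 k) • c s(j, k) := by
  simp only [evMat, Matrix.of_apply, Finset.sum_smul]
  rw [Finset.sum_comm]
  refine Finset.sum_congr rfl fun j _ => ?_
  rw [Finset.sum_comm]
  refine Finset.sum_congr rfl fun k _ => ?_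
  simp [ite_smul]

lemma evMat_map {R S ι : Type*} [CommRing R] [CommRing S] (f : R →+* S) {d : ι → ℕ} {N : ℕ}
    (X : ∀ i, Fin (d i) → Fin N → R) :
    (evMat X).map f = evMat fun i k j => f (X i k j) := by
  ext κ s
  simp only [evMat, Matrix.map_apply, Matrix.of_apply, map_sum]
  refine Finset.sum_congr rfl fun j _ => Finset.sum_congr rfl fun k _ => ?_
  split_ifs <;> simp

lemma lift_complex {ι : Type*} [Fintype ι] {d : ι → ℕ} {N p : ℕ} [Fact p.Prime]
    (X : ∀ i, Fin (d i) → Fin N → ZMod p)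
    (hX : ∀ c : Sym2 (Fin N) → ZMod p, (∀ i k l, symForm c (X i k) (X i l) = 0) → c = 0) :
    ∃ Y : ∀ i, Fin (d i) → Fin N → ℂ,
      ∃ B : Matrix (Sym2 (Fin N)) (Σ i, Fin (d i) × Fin (d i)) ℂ, B * evMat Y = 1 := by
  classical
  have hker : LinearMap.ker (Matrix.toLin' (evMat X)) = ⊥ := by
    rw [LinearMap.ker_eq_bot']
    intro c hc
    apply hX
    intro i k l
    have := congrFun hc ⟨i, k, l⟩
    rw [Matrix.toLin'_apply, Matrix.mulVec, dotProduct] at this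
    have h2 := evMat_sum X ⟨i, k, l⟩ c
    simp only [smul_eq_mul] at h2
    rw [h2] at this
    rw [symForm_apply]
    refine Eq.trans ?_ this
    refine Finset.sum_congr rfl fun j _ => Finset.sum_congr rfl fun k _ => ?_
    ring
  obtain ⟨g, hg⟩ := LinearMap.exists_leftInverse_of_injective _ hker
  have hB : LinearMap.toMatrix' g * evMat X = 1 := by
    have := congrArg LinearMap.toMatrix' hg
    rwa [LinearMap.toMatrix'_comp, LinearMap.toMatrix'_toLin', LinearMap.toMatrix'_id] at this
  set B := LinearMap.toMatrix' g
  let Xz : ∀ i, Fin (d i) → Fin N → ℤ := fun i k j => ((X i k j).val : ℤ)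
  let Bz : Matrix (Sym2 (Fin N)) (Σ i, Fin (d i) × Fin (d i)) ℤ := B.map fun x => (x.val : ℤ)
  have h1 : (evMat Xz).map (Int.castRingHom (ZMod p)) = evMat X := by
    rw [evMat_map]
    congr 1
    funext i k j
    simp [Xz]
  have h2 : Bz.map (Int.castRingHom (ZMod p)) = B := by
    ext a b
    simp [Bz]
  have h3 : (Bz * evMat Xz).det ≠ 0 := by
    intro h0
    have h4 := RingHom.map_det (Int.castRingHom (ZMod p)) (Bz * evMat Xz)
    rw [h0, RingHom.mapMatrix_apply, Matrix.map_mul, h1, h2, hB, Matrix.det_one, map_zero] at h4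
    exact zero_ne_one h4
  refine ⟨fun i k j => Int.castRingHom ℂ (Xz i k j),
    ((Bz * evMat Xz).map (Int.castRingHom ℂ))⁻¹ * Bz.map (Int.castRingHom ℂ), ?_⟩
  rw [← evMat_map, Matrix.mul_assoc, ← Matrix.map_mul]
  apply Matrix.nonsing_inv_mul
  rw [isUnit_iff_ne_zero, ← RingHom.mapMatrix_apply, ← RingHom.map_det]
  simpa using h3

lemma exists_enlarge {K V : Type*} [Field K] [AddCommGroup V] [Module K V] (H : Submodule K V)
    [FiniteDimensional K H] (k : ℕ) (hk : k ≤ Module.finrank K H) :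
    ∀ (e : ℕ) (W : Submodule K V), W ≤ H → Module.finrank K W + e = k →
      ∃ L : Submodule K V, W ≤ L ∧ L ≤ H ∧ Module.finrank K L = k := by
  intro e
  induction e with
  | zero => intro W hW h; exact ⟨W, le_rfl, hW, by omega⟩
  | succ e ih =>
    intro W hW h
    have hlt : W < H := lt_of_le_of_ne hW (fun h' => by rw [h'] at h; omega)
    obtain ⟨x, hxH, hxW⟩ := SetLike.exists_of_lt hlt
    have hfW : FiniteDimensional K W := Submodule.finiteDimensional_of_le hW
    have hxne : x ≠ 0 := fun h0 => hxW (h0 ▸ W.zero_mem)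
    have b1 := Submodule.finrank_sup_add_finrank_inf_eq W (Submodule.span K {x})
    have b2 : W ⊓ Submodule.span K {x} = ⊥ := by
      rw [← disjoint_iff]
      exact (Submodule.disjoint_span_singleton' hxne).2 hxW
    rw [b2, finrank_bot, finrank_span_singleton hxne] at b1
    obtain ⟨L, h1, h2, h3⟩ := ih (W ⊔ Submodule.span K {x})
      (sup_le hW ((Submodule.span_singleton_le_iff_mem _ _).2 hxH)) (by omega)
    exact ⟨L, le_sup_left.trans h1, h2, h3⟩

open MvPolynomial in
/-- the monomial attached to an unordered pair -/
noncomputable def pairMon {N : ℕ} (s : Sym2 (Fin N)) : MvPolynomial (Fin N) ℂ :=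
  Sym2.lift ⟨fun j k => X j * X k, fun _ _ => mul_comm _ _⟩ s

open MvPolynomial in
lemma quad_le {ι : Type*} [Fintype ι] {d : ι → ℕ} {N : ℕ}
    (Y : ∀ i, Fin (d i) → Fin N → ℂ)
    (B : Matrix (Sym2 (Fin N)) (Σ i, Fin (d i) × Fin (d i)) ℂ) (hB : B * evMat Y = 1)
    (P : ι → Submodule ℂ (MvPolynomial (Fin N) ℂ))
    (hP : ∀ i k l, (∑ j, Y i k j • X j) * (∑ j, Y i l j • X j) ∈ P i) :
    homogeneousSubmodule (Fin N) ℂ 2 ≤ ⨆ i, P i := by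
  classical
  have hmon : ∀ s : Sym2 (Fin N), pairMon s ∈ ⨆ i, P i := by
    intro s
    have h1 : pairMon s = ∑ κ : Σ i, Fin (d i) × Fin (d i), B s κ •
        ((∑ j, Y κ.1 κ.2.1 j • X j) * (∑ j, Y κ.1 κ.2.2 j • X j) : MvPolynomial (Fin N) ℂ) := by
      have h2 : ∀ κ : Σ i, Fin (d i) × Fin (d i),
          ((∑ j, Y κ.1 κ.2.1 j • X j) * (∑ j, Y κ.1 κ.2.2 j • X j) : MvPolynomial (Fin N) ℂ)
            = ∑ s', evMat Y κ s' • pairMon s' := by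
        intro κ
        rw [evMat_sum, Finset.sum_mul_sum]
        refine Finset.sum_congr rfl fun j _ => Finset.sum_congr rfl fun k _ => ?_
        rw [smul_mul_smul_comm]
        rfl
      simp only [h2, Finset.smul_sum, smul_smul]
      rw [Finset.sum_comm]
      simp only [← Finset.sum_smul]
      have h3 : ∀ s', ∑ κ, B s κ * evMat Y κ s' = (1 : Matrix (Sym2 (Fin N)) (Sym2 (Fin N)) ℂ) s s' := by
        intro s'
        rw [← hB, Matrix.mul_apply]
      simp only [h3, Matrix.one_apply, ite_smul, one_smul, zero_smul]
      simp
    rw [h1]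
    refine Submodule.sum_mem _ fun κ _ => Submodule.smul_mem _ _ ?_
    exact Submodule.mem_iSup_of_mem κ.1 (hP _ _ _)
  rw [← homogeneousSubmodule_one_pow, homogeneousSubmodule_one_eq_span_X, pow_two,
    Submodule.span_mul_span, Submodule.span_le]
  rintro _ ⟨_, ⟨j, rfl⟩, _, ⟨k, rfl⟩, rfl⟩
  exact hmon s(j, k)

end Lift

open MvPolynomial

/-- Decomposition of quadratic forms: if `m_1 ≥ … ≥ m_s ≥ 0`, `m_1 + m_2 < n` and
`Σ C(m_i+2,2) ≥ C(n+2,2)`, then there are subspaces `U_1, …, U_s` of the linear forms in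
`y_0, …, y_n` with `dim U_i = m_i + 1` such that every quadratic form is a sum
`q_1 + … + q_s` with each `q_i` in the span of the products `u * v`, `u, v ∈ U_i`;
i.e. every quadric can be written as `f_1(l_{1,0},…,l_{1,m_1}) + … + f_s(l_{s,0},…,l_{s,m_s})`
for a generic choice of linear forms. (`m` and `U` are 1-indexed.) -/
theorem stmt15 (n s : ℕ) (m : ℕ → ℕ) (hs : 2 ≤ s)
    (hmono : ∀ i j, 1 ≤ i → i ≤ j → j ≤ s → m j ≤ m i)
    (h12 : m 1 + m 2 < n)
    (hsum : (n + 2).choose 2 ≤ ∑ i ∈ Finset.Icc 1 s, (m i + 2).choose 2) :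
    ∃ U : ℕ → Submodule ℂ (MvPolynomial (Fin (n + 1)) ℂ),
      (∀ i ∈ Finset.Icc 1 s, U i ≤ homogeneousSubmodule (Fin (n + 1)) ℂ 1) ∧
      (∀ i ∈ Finset.Icc 1 s, Module.finrank ℂ (U i) = m i + 1) ∧
      ∀ f ∈ homogeneousSubmodule (Fin (n + 1)) ℂ 2,
        ∃ q : ℕ → MvPolynomial (Fin (n + 1)) ℂ,
          (∀ i ∈ Finset.Icc 1 s,
            q i ∈ Submodule.span ℂ {w | ∃ u ∈ U i, ∃ v ∈ U i, w = u * v}) ∧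
          f = ∑ i ∈ Finset.Icc 1 s, q i := by
  classical
  let ι := {i // i ∈ Finset.Icc 1 s}
  let _ : Fintype ι := Finset.Subtype.fintype (Finset.Icc 1 s)
  let d : ι → ℕ := fun i => m i.1 + 1
  have h1 : 1 ∈ Finset.Icc 1 s := Finset.mem_Icc.2 ⟨le_rfl, by omega⟩
  have h2 : 2 ∈ Finset.Icc 1 s := Finset.mem_Icc.2 ⟨by omega, hs⟩
  obtain ⟨p, hp, X0, hX0⟩ := exists_good d (n + 1) ⟨1, h1⟩ ⟨2, h2⟩
    (fun h => absurd (congrArg Subtype.val h) (by norm_num))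
    (by
      rintro ⟨i, hi⟩ hne
      have hi' := Finset.mem_Icc.1 hi
      have : i ≠ 1 := fun h => hne (Subtype.ext h)
      have := hmono 2 i (by omega) (by omega) hi'.2
      simp only [d]; omega)
    (by
      have := hmono 1 2 le_rfl (by omega) hs
      simp only [d]; omega)
    (by simp only [d]; omega)
    (by
      have e : ∑ i : ι, QTri (d i) = ∑ i ∈ Finset.Icc 1 s, (m i + 2).choose 2 :=
        Finset.sum_coe_sort (Finset.Icc 1 s) fun i => (m i + 2).choose 2
      rw [e]
      exact hsum)
  obtain ⟨Y, B, hB⟩ := lift_complex X0 hX0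
  let H : Submodule ℂ (MvPolynomial (Fin (n + 1)) ℂ) :=
    Submodule.span ℂ (Set.range (X : Fin (n + 1) → MvPolynomial (Fin (n + 1)) ℂ))
  have hHfin : FiniteDimensional ℂ H := FiniteDimensional.span_of_finite ℂ (Set.finite_range _)
  have hH : Module.finrank ℂ H = n + 1 := by
    have := finrank_span_eq_card (R := ℂ) (linearIndependent_X (Fin (n + 1)) ℂ)
    simpa using this
  have hHom : homogeneousSubmodule (Fin (n + 1)) ℂ 1 = H := homogeneousSubmodule_one_eq_span_X ..
  let u : ∀ i : ι, Fin (d i) → MvPolynomial (Fin (n + 1)) ℂ := fun i k => ∑ j, Y i k j • X j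
  have hex : ∀ i : ι, ∃ L : Submodule ℂ (MvPolynomial (Fin (n + 1)) ℂ),
      Submodule.span ℂ (Set.range (u i)) ≤ L ∧ L ≤ H ∧ Module.finrank ℂ L = d i := by
    intro i
    have hi := Finset.mem_Icc.1 i.2
    have hle : m i.1 ≤ m 1 := hmono 1 i.1 le_rfl hi.1 hi.2
    have hr : Module.finrank ℂ (Submodule.span ℂ (Set.range (u i))) ≤ d i := by
      have := finrank_range_le_card (R := ℂ) (u i)
      rw [Fintype.card_fin] at this
      exact this
    refine exists_enlarge H (d i) (by rw [hH]; simp only [d]; omega)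
      (d i - Module.finrank ℂ (Submodule.span ℂ (Set.range (u i)))) _ ?_ (by omega)
    rw [Submodule.span_le]
    rintro _ ⟨k, rfl⟩
    exact Submodule.sum_mem _ fun j _ => Submodule.smul_mem _ _ (Submodule.subset_span ⟨j, rfl⟩)
  choose L hL1 hL2 hL3 using hex
  obtain ⟨U, hU⟩ : ∃ U : ℕ → Submodule ℂ (MvPolynomial (Fin (n + 1)) ℂ),
      ∀ i (hi : i ∈ Finset.Icc 1 s), U i = L ⟨i, hi⟩ :=
    ⟨fun i => if hi : i ∈ Finset.Icc 1 s then L ⟨i, hi⟩ else ⊥, fun i hi => dif_pos hi⟩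
  refine ⟨U, ?_, ?_, ?_⟩
  · intro i hi
    rw [hU i hi, hHom]
    exact hL2 _
  · intro i hi
    rw [hU i hi]
    exact hL3 _
  · intro f hf
    let P : ι → Submodule ℂ (MvPolynomial (Fin (n + 1)) ℂ) := fun i =>
      Submodule.span ℂ {w | ∃ u ∈ L i, ∃ v ∈ L i, w = u * v}
    have hmem := quad_le Y B hB P (fun i k l => Submodule.subset_span
      ⟨_, hL1 i (Submodule.subset_span ⟨k, rfl⟩), _, hL1 i (Submodule.subset_span ⟨l, rfl⟩), rfl⟩) hf
    have hmem' : f ∈ ⨆ i ∈ (Finset.univ : Finset ι), P i := by simpa using hmem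
    rw [Submodule.mem_iSup_finset_iff_exists_sum] at hmem'
    obtain ⟨μ, hμ⟩ := hmem'
    refine ⟨fun i => if hi : i ∈ Finset.Icc 1 s then (μ ⟨i, hi⟩ : MvPolynomial (Fin (n + 1)) ℂ)
      else 0, ?_, ?_⟩
    · intro i hi
      beta_reduce
      rw [hU i hi, dif_pos hi]
      exact (μ ⟨i, hi⟩).2
    · rw [← hμ, ← Finset.sum_coe_sort (Finset.Icc 1 s)]
      refine Finset.sum_congr rfl fun i _ => ?_
      rw [dif_pos i.2]
end
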